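/- arXiv:1010.1341 — 10 statements merged into one kernel-verified Lean document; each statement's English description precedes it below -/
import Mathlib

section
/- Let V be a real inner product space of dimension 2n with n ≥ 2, with inner product g and a linear isometry J : V → V satisfying J∘J = −id, and let R be an algebraic curvature tensor on V. Then R has constant antiholomorphic sectional curvature ν if and only if R = (1/(2(n+1)))·ψ(ρ*(R)) + ν·π₁ − ((2(n+1)ν + τ*(R))/(2(n+1)(2n+1)))·π₂. -/
open scoped RealInnerProductSpace BigOperators

/-- The `*`-Ricci tensor of a (0,4)-tensor `R`, computed via the orthonormal basis `b`:
`ρ*(R)(X,Y) = Σ_i R(e_i, X, J e_i, J Y)`. -/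
noncomputable def rhoStar {V : Type*} [NormedAddCommGroup V] [InnerProductSpace ℝ V]
    {ι : Type*} [Fintype ι] (b : OrthonormalBasis ι ℝ V) (J : V →ₗ[ℝ] V)
    (R : V → V → V → V → ℝ) (X Y : V) : ℝ :=
  ∑ i, R (b i) X (J (b i)) (J Y)

/-- The `*`-scalar curvature: `τ*(R) = Σ_i ρ*(R)(e_i, e_i)`. -/
noncomputable def tauStar {V : Type*} [NormedAddCommGroup V] [InnerProductSpace ℝ V]
    {ι : Type*} [Fintype ι] (b : OrthonormalBasis ι ℝ V) (J : V →ₗ[ℝ] V)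
    (R : V → V → V → V → ℝ) : ℝ :=
  ∑ i, rhoStar b J R (b i) (b i)

/-- `ψ(S)(X,Y,Z,W)` for a bilinear-form-like map `S`. -/
noncomputable def psiT {V : Type*} [NormedAddCommGroup V] [InnerProductSpace ℝ V]
    (J : V →ₗ[ℝ] V) (S : V → V → ℝ) (X Y Z W : V) : ℝ :=
  2 * ⟪X, J Y⟫ * S Z (J W) + 2 * ⟪Z, J W⟫ * S X (J Y)
    + ⟪X, J Z⟫ * S Y (J W) + ⟪Y, J W⟫ * S X (J Z)
    - ⟪X, J W⟫ * S Y (J Z) - ⟪Y, J Z⟫ * S X (J W)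

/-- `π₁(X,Y,Z,W) = g(X,Z)g(Y,W) − g(Y,Z)g(X,W)`. -/
noncomputable def piOne {V : Type*} [NormedAddCommGroup V] [InnerProductSpace ℝ V]
    (X Y Z W : V) : ℝ :=
  ⟪X, Z⟫ * ⟪Y, W⟫ - ⟪Y, Z⟫ * ⟪X, W⟫

/-- `π₂(X,Y,Z,W) = 2g(JX,Y)g(JZ,W) + g(JX,Z)g(JY,W) − g(JY,Z)g(JX,W)`. -/
noncomputable def piTwo {V : Type*} [NormedAddCommGroup V] [InnerProductSpace ℝ V]
    (J : V →ₗ[ℝ] V) (X Y Z W : V) : ℝ :=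
  2 * ⟪J X, Y⟫ * ⟪J Z, W⟫ + ⟪J X, Z⟫ * ⟪J Y, W⟫ - ⟪J Y, Z⟫ * ⟪J X, W⟫

/-- Algebraic curvature tensors, as functions. -/
structure IsCurv {V : Type*} [AddCommGroup V] [Module ℝ V] (F : V → V → V → V → ℝ) : Prop where
  add1 : ∀ A B Y Z W, F (A + B) Y Z W = F A Y Z W + F B Y Z W
  smul1 : ∀ (c : ℝ) A Y Z W, F (c • A) Y Z W = c * F A Y Z W
  a1 : ∀ X Y Z W, F X Y Z W = - F Y X Z W
  pair : ∀ X Y Z W, F X Y Z W = F Z W X Y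
  bianchi : ∀ X Y Z W, F X Y Z W + F Y Z X W + F Z X Y W = 0

namespace IsCurv
variable {V : Type*} [AddCommGroup V] [Module ℝ V] {F : V → V → V → V → ℝ}

lemma a2 (h : IsCurv F) (X Y Z W : V) : F X Y Z W = - F X Y W Z := by
  rw [h.pair, h.a1, h.pair]

lemma add2 (h : IsCurv F) (A B Y Z W : V) : F Y (A + B) Z W = F Y A Z W + F Y B Z W := by
  rw [h.a1, h.add1, h.a1 A, h.a1 B]; ring

lemma smul2 (h : IsCurv F) (c : ℝ) (A Y Z W : V) : F Y (c • A) Z W = c * F Y A Z W := by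
  rw [h.a1, h.smul1, h.a1 A]; ring

lemma add3 (h : IsCurv F) (A B Y Z W : V) : F Y Z (A + B) W = F Y Z A W + F Y Z B W := by
  rw [h.pair, h.add1, h.pair A, h.pair B]

lemma smul3 (h : IsCurv F) (c : ℝ) (A Y Z W : V) : F Y Z (c • A) W = c * F Y Z A W := by
  rw [h.pair, h.smul1, h.pair A]

lemma add4 (h : IsCurv F) (A B Y Z W : V) : F Y Z W (A + B) = F Y Z W A + F Y Z W B := by
  rw [h.pair, h.add2, h.pair W A, h.pair W B]

lemma smul4 (h : IsCurv F) (c : ℝ) (A Y Z W : V) : F Y Z W (c • A) = c * F Y Z W A := by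
  rw [h.pair, h.smul2, h.pair W A]

lemma self12 (h : IsCurv F) (X Z W : V) : F X X Z W = 0 := by
  have := h.a1 X X Z W; linarith

lemma self34 (h : IsCurv F) (X Z W : V) : F Z W X X = 0 := by
  have := h.a2 Z W X X; linarith

lemma eq_zero (h : IsCurv F) (h0 : ∀ X Y, F X Y X Y = 0) (X Y Z W : V) : F X Y Z W = 0 := by
  have h1 : ∀ X Y Z, F X Y Z Y = 0 := by
    intro X Y Z
    have e := h0 (X + Z) Y
    rw [h.add1, h.add3, h.add3, h0, h0] at e
    have := h.pair Z Y X Y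
    linarith
  have h2 : ∀ X Y Z W, F X Y Z W = - F X W Z Y := by
    intro X Y Z W
    have e := h1 X (Y + W) Z
    rw [h.add2, h.add4, h.add4, h1, h1] at e
    linarith
  have b := h.bianchi X Y Z W
  -- F Y Z X W and F Z X Y W equal F X Y Z W
  have e1 : F Y Z X W = F X Y Z W := by
    have := h2 Y Z X W
    have := h.pair X Y Z W
    have := h.a1 Y W X Z
    have := h.a2 Y W X Z
    have := h.a1 Z W X Y
    have := h2 X Y Z W
    have := h.pair Y W X Z
    have := h2 X Z Y W
    have := h.pair X W Y Z
    have := h.pair X W Z Y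
    have := h.a2 X W Z Y
    linarith
  have e2 : F Z X Y W = F X Y Z W := by
    have := h2 X Y Z W
    have := h.a1 Z X Y W
    have := h2 X Z Y W
    have := h.a2 X W Y Z
    linarith
  linarith

lemma sub {G : V → V → V → V → ℝ} (h : IsCurv F) (h' : IsCurv G) (c : ℝ) :
    IsCurv (fun X Y Z W => F X Y Z W - c * G X Y Z W) where
  add1 A B Y Z W := by rw [h.add1, h'.add1]; ring
  smul1 c A Y Z W := by rw [h.smul1, h'.smul1]; ring
  a1 X Y Z W := by rw [h.a1, h'.a1]; ring
  pair X Y Z W := by rw [h.pair, h'.pair]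
  bianchi X Y Z W := by linear_combination h.bianchi X Y Z W - c * h'.bianchi X Y Z W

end IsCurv

section helpers
variable {V : Type*} [NormedAddCommGroup V] [InnerProductSpace ℝ V]

lemma isCurv_piOne : IsCurv (piOne (V := V)) where
  add1 A B Y Z W := by simp only [piOne, inner_add_left]; ring
  smul1 c A Y Z W := by simp only [piOne, real_inner_smul_left]; ring
  a1 X Y Z W := by simp only [piOne]; ring
  pair X Y Z W := by
    simp only [piOne, real_inner_comm Z, real_inner_comm W]; ring
  bianchi X Y Z W := by
    simp only [piOne]
    rw [real_inner_comm X Y, real_inner_comm X Z, real_inner_comm Y Z]; ring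

lemma omega_anti (J : V →ₗ[ℝ] V) (hJ2 : ∀ X : V, J (J X) = -X)
    (hJiso : ∀ X Y : V, ⟪J X, J Y⟫ = ⟪X, Y⟫) (X Y : V) : ⟪X, J Y⟫ = -⟪Y, J X⟫ := by
  rw [← hJiso X (J Y), hJ2, inner_neg_right, real_inner_comm]

/-- `ψ` in terms of the 2-form `s`. -/
noncomputable def psiA (J : V →ₗ[ℝ] V) (s : V →ₗ[ℝ] V →ₗ[ℝ] ℝ) (X Y Z W : V) : ℝ :=
  2 * ⟪X, J Y⟫ * s Z W + 2 * ⟪Z, J W⟫ * s X Y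
    + ⟪X, J Z⟫ * s Y W + ⟪Y, J W⟫ * s X Z
    - ⟪X, J W⟫ * s Y Z - ⟪Y, J Z⟫ * s X W

lemma isCurv_psiA (J : V →ₗ[ℝ] V) (hJ2 : ∀ X : V, J (J X) = -X)
    (hJiso : ∀ X Y : V, ⟪J X, J Y⟫ = ⟪X, Y⟫) (s : V →ₗ[ℝ] V →ₗ[ℝ] ℝ)
    (hs : ∀ X Y, s X Y = - s Y X) : IsCurv (psiA J s) where
  add1 A B Y Z W := by
    simp only [psiA, inner_add_left, map_add, LinearMap.add_apply]; ring
  smul1 c A Y Z W := by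
    simp only [psiA, real_inner_smul_left, map_smul, LinearMap.smul_apply, smul_eq_mul]; ring
  a1 X Y Z W := by
    simp only [psiA]
    rw [omega_anti J hJ2 hJiso X Y, hs X Y]; ring
  pair X Y Z W := by
    simp only [psiA]
    rw [omega_anti J hJ2 hJiso X Z, omega_anti J hJ2 hJiso X W, omega_anti J hJ2 hJiso Y Z,
      omega_anti J hJ2 hJiso Y W, hs X Z, hs X W, hs Y Z, hs Y W]; ring
  bianchi X Y Z W := by
    simp only [psiA]
    rw [omega_anti J hJ2 hJiso Y X, omega_anti J hJ2 hJiso Z X, omega_anti J hJ2 hJiso Z Y,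
      hs Y X, hs Z X, hs Z Y]; ring

/-- A linear functional vanishing wherever three nonzero functionals are nonzero is zero. -/
lemma functional_zero (L : V →ₗ[ℝ] ℝ) (fs : Fin 3 → (V →ₗ[ℝ] ℝ)) (hf : ∀ i, fs i ≠ 0)
    (h : ∀ Y, (∀ i, fs i Y ≠ 0) → L Y = 0) : L = 0 := by
  by_contra hL
  let ps : Option (Fin 3) → Submodule ℝ V := fun o => o.elim (LinearMap.ker L)
    (fun i => LinearMap.ker (fs i))
  have hu : (⋃ o ∈ (Finset.univ : Finset (Option (Fin 3))), (ps o : Set V)) = Set.univ := by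
    ext Y
    simp only [Finset.mem_univ, Set.iUnion_true, Set.mem_iUnion, Set.mem_univ, iff_true]
    by_cases hY : ∀ i, fs i Y ≠ 0
    · exact ⟨none, h Y hY⟩
    · push Not at hY
      obtain ⟨i, hi⟩ := hY
      exact ⟨some i, hi⟩
  have hm := fun h => Subspace.biUnion_ne_univ_of_top_notMem (k := ℝ)
    (s := Finset.univ.image ps) h
  have : (⊤ : Submodule ℝ V) ∈ Finset.univ.image ps := by
    by_contra hne
    apply hm hne
    rw [← hu]
    ext; simp
  simp only [Finset.mem_image, Finset.mem_univ, true_and] at this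
  obtain ⟨o, ho⟩ := this
  cases o with
  | none => exact hL (LinearMap.ker_eq_top.mp ho)
  | some i => exact hf i (LinearMap.ker_eq_top.mp ho)

lemma exists_form (J : V →ₗ[ℝ] V) (hJ2 : ∀ X : V, J (J X) = -X)
    (hJiso : ∀ X Y : V, ⟪J X, J Y⟫ = ⟪X, Y⟫) {F : V → V → V → V → ℝ} (hF : IsCurv F)
    (h0 : ∀ X Y, ⟪X, J Y⟫ = 0 → F X Y X Y = 0) :
    ∃ s : V →ₗ[ℝ] V →ₗ[ℝ] ℝ, (∀ X Y, s X Y = - s Y X) ∧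
      ∀ X Y, F X Y X Y = ⟪X, J Y⟫ * s X Y := by
  let a : V → V → ℝ := fun X Y =>
    (-2 * ⟪X, X⟫ * F X Y X (J X) - ⟪X, J Y⟫ * F X (J X) X (J X)) / ⟪X, X⟫ ^ 2
  have zero1 : ∀ Y Z W, F 0 Y Z W = 0 := by
    intro Y Z W
    have := hF.smul1 0 0 Y Z W
    simpa using this
  have a_zero : ∀ Y, a 0 Y = 0 := by intro Y; simp [a]
  have a_add : ∀ X A B, a X (A + B) = a X A + a X B := by
    intro X A B
    simp only [a, hF.add2, map_add, inner_add_right]; ring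
  have a_smul : ∀ (c : ℝ) X A, a X (c • A) = c * a X A := by
    intro c X A
    simp only [a, hF.smul2, map_smul, real_inner_smul_right]; ring
  have a_smul1 : ∀ (c : ℝ) X A, a (c • X) A = c * a X A := by
    intro c X A
    rcases eq_or_ne c 0 with rfl | hc
    · simp [a_zero]
    rcases eq_or_ne X 0 with rfl | hX
    · simp [a_zero]
    have hX' : ⟪X, X⟫ ≠ 0 := inner_self_ne_zero.mpr hX
    simp only [a, hF.smul1, hF.smul2, hF.smul3, hF.smul4, map_smul, real_inner_smul_right,
      real_inner_smul_left]
    field_simp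
  have hXJX : ∀ X : V, ⟪X, J X⟫ = 0 := by
    intro X; have := omega_anti J hJ2 hJiso X X; linarith
  have a_self : ∀ X, a X X = 0 := by
    intro X; simp [a, hF.self12, hXJX]
  have hQ : ∀ X Y, F X Y X Y = ⟪X, J Y⟫ * a X Y := by
    intro X Y
    rcases eq_or_ne X 0 with rfl | hX
    · simp [zero1]
    have hX' : ⟪X, X⟫ ≠ 0 := inner_self_ne_zero.mpr hX
    have e := h0 X (⟪X, X⟫ • Y + ⟪X, J Y⟫ • J X) (by
      rw [map_add, map_smul, map_smul, hJ2, inner_add_right, real_inner_smul_right,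
        real_inner_smul_right, inner_neg_right]; ring)
    simp only [hF.add2, hF.add4, hF.smul2, hF.smul4] at e
    have p := hF.pair X (J X) X Y
    simp only [a]
    field_simp
    rw [p] at e
    linear_combination e
  have a_anti : ∀ X Y, ⟪X, J Y⟫ ≠ 0 → a X Y = - a Y X := by
    intro X Y h
    have e1 := hQ X Y
    have e2 := hQ Y X
    have e3 : F X Y X Y = F Y X Y X := by rw [hF.a1, hF.a2]; ring
    rw [omega_anti J hJ2 hJiso Y X] at e2
    apply mul_left_cancel₀ h
    linarith
  have a_add1 : ∀ A B Y, a (A + B) Y = a A Y + a B Y := by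
    intro A B Y
    rcases eq_or_ne A 0 with rfl | hA
    · simp [a_zero]
    rcases eq_or_ne B 0 with rfl | hB
    · simp [a_zero]
    rcases eq_or_ne (A + B) 0 with hAB | hAB
    · have : B = (-1 : ℝ) • A := by rw [neg_one_smul]; exact (neg_eq_of_add_eq_zero_right hAB).symm
      rw [hAB, a_zero, this, a_smul1]; ring
    let L : V →ₗ[ℝ] ℝ :=
      { toFun := fun Y => a (A + B) Y - a A Y - a B Y
        map_add' := by intro x y; simp only [a_add]; ring
        map_smul' := by intro c x; simp only [a_smul, RingHom.id_apply, smul_eq_mul]; ring }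
    let om : V → V →ₗ[ℝ] ℝ := fun X => (innerₗ V X).comp J
    have om_ne : ∀ X, X ≠ 0 → om X ≠ 0 := by
      intro X hX h
      have : om X (J X) = 0 := by rw [h]; rfl
      simp only [om, LinearMap.comp_apply, hJ2, innerₗ_apply_apply, inner_neg_right, neg_eq_zero]
        at this
      exact hX (inner_self_eq_zero.mp this)
    have hL : L = 0 := by
      apply functional_zero L ![om A, om B, om (A + B)]
      · intro i; fin_cases i
        · exact om_ne _ hA
        · exact om_ne _ hB
        · exact om_ne _ hAB
      · intro Z hZ
        have z0 : ⟪A, J Z⟫ ≠ 0 := hZ 0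
        have z1 : ⟪B, J Z⟫ ≠ 0 := hZ 1
        have z2 : ⟪A + B, J Z⟫ ≠ 0 := hZ 2
        change a (A + B) Z - a A Z - a B Z = 0
        rw [a_anti _ _ z0, a_anti _ _ z1, a_anti _ _ z2, a_add]; ring
    have : L Y = 0 := by rw [hL]; rfl
    change a (A + B) Y - a A Y - a B Y = 0 at this
    linarith
  refine ⟨LinearMap.mk₂ ℝ a a_add1 a_smul1 a_add a_smul, ?_, hQ⟩
  intro X Y
  simp only [LinearMap.mk₂_apply]
  have := a_self (X + Y)
  rw [a_add1, a_add, a_add, a_self, a_self] at this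
  linarith

lemma sec_formula (J : V →ₗ[ℝ] V) (hJ2 : ∀ X : V, J (J X) = -X)
    (hJiso : ∀ X Y : V, ⟪J X, J Y⟫ = ⟪X, Y⟫) {F : V → V → V → V → ℝ} (hF : IsCurv F) (ν : ℝ)
    (h : ∀ X Y : V, ⟪X, X⟫ = 1 → ⟪Y, Y⟫ = 1 → ⟪X, Y⟫ = 0 → ⟪X, J Y⟫ = 0 →
        F X Y X Y = ν) (X Y : V) (hXY : ⟪X, J Y⟫ = 0) :
    F X Y X Y - ν * piOne X Y X Y = 0 := by
  have hG : IsCurv (fun X Y Z W => F X Y Z W - ν * piOne X Y Z W) := hF.sub isCurv_piOne ν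
  set G := (fun X Y Z W => F X Y Z W - ν * piOne X Y Z W) with hGdef
  have hX0 : ∀ X : V, ⟪X, J X⟫ = 0 := by
    intro X; have := omega_anti J hJ2 hJiso X X; linarith
  have zero1 : ∀ Y Z W, G 0 Y Z W = 0 := by
    intro Y Z W; simpa using hG.smul1 0 0 Y Z W
  have zero2 : ∀ Y Z W, G Y 0 Z W = 0 := by
    intro Y Z W; simpa using hG.smul2 0 0 Y Z W
  have key : ∀ X Y : V, ⟪X, Y⟫ = 0 → ⟪X, J Y⟫ = 0 → G X Y X Y = 0 := by
    intro X Y h1 h2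
    rcases eq_or_ne X 0 with rfl | hX
    · exact zero1 _ _ _
    rcases eq_or_ne Y 0 with rfl | hY
    · exact zero2 _ _ _
    have nX : ‖X‖ ≠ 0 := norm_ne_zero_iff.mpr hX
    have nY : ‖Y‖ ≠ 0 := norm_ne_zero_iff.mpr hY
    have i1 : ⟪‖X‖⁻¹ • X, ‖X‖⁻¹ • X⟫ = 1 := by
      rw [real_inner_smul_left, real_inner_smul_right, real_inner_self_eq_norm_sq]; field_simp
    have i2 : ⟪‖Y‖⁻¹ • Y, ‖Y‖⁻¹ • Y⟫ = 1 := by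
      rw [real_inner_smul_left, real_inner_smul_right, real_inner_self_eq_norm_sq]; field_simp
    have i3 : ⟪‖X‖⁻¹ • X, ‖Y‖⁻¹ • Y⟫ = 0 := by
      rw [real_inner_smul_left, real_inner_smul_right, h1]; ring
    have i4 : ⟪‖X‖⁻¹ • X, J (‖Y‖⁻¹ • Y)⟫ = 0 := by
      rw [map_smul, real_inner_smul_left, real_inner_smul_right, h2]; ring
    have e := h _ _ i1 i2 i3 i4
    have e' : G (‖X‖⁻¹ • X) (‖Y‖⁻¹ • Y) (‖X‖⁻¹ • X) (‖Y‖⁻¹ • Y) = 0 := by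
      simp only [hGdef, e, piOne, i1, i2, i3, real_inner_comm (‖X‖⁻¹ • X) (‖Y‖⁻¹ • Y)]
      ring
    rw [hG.smul1, hG.smul2, hG.smul3, hG.smul4] at e'
    simpa [nX, nY] using e'
  rcases eq_or_ne X 0 with rfl | hX
  · exact zero1 _ _ _
  have hX' : ⟪X, X⟫ ≠ 0 := inner_self_ne_zero.mpr hX
  have e := key X (⟪X, X⟫ • Y + (-⟪X, Y⟫) • X)
    (by rw [inner_add_right, real_inner_smul_right, real_inner_smul_right]; ring)
    (by rw [map_add, map_smul, map_smul, inner_add_right, real_inner_smul_right,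
          real_inner_smul_right, hXY, hX0]; ring)
  rw [hG.add2, hG.add4, hG.add4] at e
  simp only [hG.smul2, hG.smul4, hG.self12, hG.self34] at e
  have e2 : ⟪X, X⟫ * (⟪X, X⟫ * G X Y X Y) = 0 := by linarith
  exact (mul_eq_zero.mp ((mul_eq_zero.mp e2).resolve_left hX')).resolve_left hX'

lemma sum_inner_mul_lin {ι : Type*} [Fintype ι] (b : OrthonormalBasis ι ℝ V)
    (f : V →ₗ[ℝ] ℝ) (v : V) : ∑ i, ⟪b i, v⟫ * f (b i) = f v := by
  conv_rhs => rw [← b.sum_repr' v]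
  simp

/-- The forward computation of `ρ*`. -/
lemma rho_formula (n : ℕ) (b : OrthonormalBasis (Fin (2 * n)) ℝ V)
    (J : V →ₗ[ℝ] V) (hJ2 : ∀ X : V, J (J X) = -X)
    (hJiso : ∀ X Y : V, ⟪J X, J Y⟫ = ⟪X, Y⟫) (F : V → V → V → V → ℝ) (ν : ℝ)
    (s : V →ₗ[ℝ] V →ₗ[ℝ] ℝ) (hs : ∀ X Y, s X Y = - s Y X)
    (hFs : ∀ X Y Z W, F X Y Z W = ν * piOne X Y Z W + psiA J s X Y Z W) (X Y : V) :
    rhoStar b J F X (J Y) =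
      (2 * n + 2) * s X Y + (ν - ∑ i, s (b i) (J (b i))) * ⟪X, J Y⟫ := by
  have hX0 : ∀ X : V, ⟪X, J X⟫ = 0 := by
    intro X; have := omega_anti J hJ2 hJiso X X; linarith
  have hb : ∀ i, ⟪b i, b i⟫ = 1 := by
    intro i; rw [real_inner_self_eq_norm_sq, b.orthonormal.1 i]; norm_num
  have s1 := sum_inner_mul_lin b ((innerₗ V).flip (J X)) Y
  have s2 := sum_inner_mul_lin b ((s.flip Y).comp J) (J X)
  have s3 := sum_inner_mul_lin b (s.flip X) Y
  have s4 := sum_inner_mul_lin b ((s X).comp J) (J Y)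
  have s5 := sum_inner_mul_lin b (s.flip Y) X
  simp only [LinearMap.flip_apply, LinearMap.comp_apply, innerₗ_apply_apply, hJ2, map_neg,
    LinearMap.neg_apply] at s1 s2 s3 s4 s5
  have term : ∀ i, F (b i) X (J (b i)) (J (J Y)) =
      - ν * (⟪b i, Y⟫ * ⟪b i, J X⟫) - 2 * (⟪b i, J X⟫ * s (J (b i)) Y)
       - 2 * (⟪b i, Y⟫ * s (b i) X) + s X Y - ⟪X, J Y⟫ * s (b i) (J (b i))
       + ⟪b i, J Y⟫ * s X (J (b i)) - ⟪b i, X⟫ * s (b i) Y := by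
    intro i
    rw [hFs]
    simp only [piOne, psiA, hJ2, map_neg, inner_neg_right, hJiso, hX0, hb]
    rw [omega_anti J hJ2 hJiso X (b i), real_inner_comm (b i) X]
    ring
  unfold rhoStar
  rw [Finset.sum_congr rfl (fun i _ => term i)]
  simp only [Finset.sum_add_distrib, Finset.sum_sub_distrib, ← Finset.mul_sum, s1, s2, s3, s4, s5]
  rw [omega_anti J hJ2 hJiso X Y, hs Y X]
  simp
  ring

end helpers

/-- Ganchev: an algebraic curvature tensor `R` on a `2n`-dimensional
almost Hermitian inner product space (`n ≥ 2`) has constant antiholomorphic sectional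
curvature `ν` iff
`R = (1/(2(n+1)))·ψ(ρ*(R)) + ν·π₁ − ((2(n+1)ν + τ*(R))/(2(n+1)(2n+1)))·π₂`. -/
theorem constant_antiholomorphic_iff_ganchev
    {V : Type*} [NormedAddCommGroup V] [InnerProductSpace ℝ V]
    [FiniteDimensional ℝ V] (n : ℕ) (hn : 2 ≤ n)
    (hdim : Module.finrank ℝ V = 2 * n)
    (b : OrthonormalBasis (Fin (2 * n)) ℝ V)
    (J : V →ₗ[ℝ] V)
    (hJ2 : ∀ X : V, J (J X) = -X)
    (hJiso : ∀ X Y : V, ⟪J X, J Y⟫ = ⟪X, Y⟫)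
    (R : V →ₗ[ℝ] V →ₗ[ℝ] V →ₗ[ℝ] V →ₗ[ℝ] ℝ)
    (hR1 : ∀ X Y Z W : V, R X Y Z W = - R Y X Z W)
    (hR2 : ∀ X Y Z W : V, R X Y Z W = - R X Y W Z)
    (hR3 : ∀ X Y Z W : V, R X Y Z W = R Z W X Y)
    (hBianchi : ∀ X Y Z W : V, R X Y Z W + R Y Z X W + R Z X Y W = 0)
    (ν : ℝ) :
    (∀ X Y : V, ⟪X, X⟫ = 1 → ⟪Y, Y⟫ = 1 → ⟪X, Y⟫ = 0 → ⟪X, J Y⟫ = 0 →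
        R X Y X Y = ν) ↔
      (∀ X Y Z W : V, R X Y Z W =
        (1 / (2 * ((n : ℝ) + 1))) *
            psiT J (rhoStar b J (fun a b' c d => R a b' c d)) X Y Z W
          + ν * piOne X Y Z W
          - ((2 * ((n : ℝ) + 1) * ν + tauStar b J (fun a b' c d => R a b' c d)) /
              (2 * ((n : ℝ) + 1) * (2 * (n : ℝ) + 1))) * piTwo J X Y Z W) := by
  have hRc : IsCurv (fun a b' c d => R a b' c d) :=
    { add1 := by intros; simp
      smul1 := by intros; simp
      a1 := hR1
      pair := hR3
      bianchi := hBianchi }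
  have hX0 : ∀ X : V, ⟪X, J X⟫ = 0 := by
    intro X; have := omega_anti J hJ2 hJiso X X; linarith
  have hn1 : (n : ℝ) + 1 ≠ 0 := by positivity
  have hn2 : 2 * (n : ℝ) + 1 ≠ 0 := by positivity
  constructor
  · intro h
    obtain ⟨s', hs', hQ⟩ := exists_form J hJ2 hJiso (hRc.sub isCurv_piOne ν)
      (sec_formula J hJ2 hJiso hRc ν h)
    obtain ⟨s, hs6⟩ : ∃ s : V →ₗ[ℝ] V →ₗ[ℝ] ℝ, ∀ X Y, s' X Y = 6 * s X Y :=
      ⟨(1 / 6 : ℝ) • s', by intro X Y; simp⟩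
    have hs : ∀ X Y, s X Y = - s Y X := by
      intro X Y; have := hs' X Y; rw [hs6, hs6] at this; linarith
    have hD := ((hRc.sub isCurv_piOne ν).sub (isCurv_psiA J hJ2 hJiso s hs) 1).eq_zero (by
      intro X Y
      have q := hQ X Y
      have hsX : s X X = 0 := by have := hs X X; linarith
      beta_reduce at q ⊢
      rw [q, hs6]
      simp only [psiA, hX0, omega_anti J hJ2 hJiso Y X, hs Y X, hsX]
      ring)
    have hFs : ∀ X Y Z W, (fun a b' c d => R a b' c d) X Y Z W
        = ν * piOne X Y Z W + psiA J s X Y Z W := by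
      intro X Y Z W; have := hD X Y Z W; beta_reduce at this ⊢; linarith
    have hrho := rho_formula n b J hJ2 hJiso _ ν s hs hFs
    set T := ∑ i, s (b i) (J (b i)) with hT
    have htau : tauStar b J (fun a b' c d => R a b' c d) = 2 * n * ν - (4 * n + 2) * T := by
      unfold tauStar
      have term : ∀ i, rhoStar b J (fun a b' c d => R a b' c d) (b i) (b i)
          = -((2 * n + 2) * s (b i) (J (b i))) + (ν - T) := by
        intro i
        have e := hrho (b i) (-(J (b i)))
        have hb : ⟪b i, b i⟫ = 1 := by
          rw [real_inner_self_eq_norm_sq, b.orthonormal.1 i]; norm_num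
        simp only [map_neg, hJ2, neg_neg, hb] at e
        rw [e]; ring
      rw [Finset.sum_congr rfl (fun i _ => term i)]
      simp only [Finset.sum_add_distrib, Finset.sum_neg_distrib, ← Finset.mul_sum, ← hT]
      simp
      ring
    intro X Y Z W
    have e := hFs X Y Z W
    beta_reduce at e
    rw [e, htau]
    simp only [psiT, hrho, psiA, piTwo]
    have c : ∀ A B : V, ⟪J A, B⟫ = -⟪A, J B⟫ := by
      intro A B; rw [real_inner_comm, omega_anti J hJ2 hJiso]
    simp only [c]
    field_simp
    ring
  · intro h X Y hX hY hXY hJ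
    have hJ' : ⟪Y, J X⟫ = 0 := by rw [omega_anti J hJ2 hJiso, hJ, neg_zero]
    rw [h]
    have c : ∀ A B : V, ⟪J A, B⟫ = -⟪A, J B⟫ := by
      intro A B; rw [real_inner_comm, omega_anti J hJ2 hJiso]
    have hYX : ⟪Y, X⟫ = 0 := by rw [real_inner_comm, hXY]
    simp only [psiT, piOne, piTwo, c, hX, hY, hXY, hYX, hJ, hJ', hX0]
    ring
end

section
/- Let V be a real inner product space of dimension 2n with n ≥ 2, with inner product g and a linear isometry J : V → V satisfying J∘J = −id, and let R be an algebraic curvature tensor on V with constant antiholomorphic sectional curvature ν. Then ρ*(R + L₃R) = (2(n+1)/3)·ρ(R) − (((n+1)τ(R) − 3τ*(R))/(3n))·g. -/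
open scoped RealInnerProductSpace BigOperators

/-- The Ricci tensor of a (0,4)-tensor `R`, computed via the orthonormal basis `b`:
`ρ(R)(X,Y) = Σ_i R(e_i, X, e_i, Y)`. -/
noncomputable def ricci {V : Type*} [NormedAddCommGroup V] [InnerProductSpace ℝ V]
    {ι : Type*} [Fintype ι] (b : OrthonormalBasis ι ℝ V)
    (R : V → V → V → V → ℝ) (X Y : V) : ℝ :=
  ∑ i, R (b i) X (b i) Y

/-- The scalar curvature: `τ(R) = Σ_i ρ(R)(e_i, e_i)`. -/
noncomputable def scalarCurv {V : Type*} [NormedAddCommGroup V] [InnerProductSpace ℝ V]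
    {ι : Type*} [Fintype ι] (b : OrthonormalBasis ι ℝ V)
    (R : V → V → V → V → ℝ) : ℝ :=
  ∑ i, ricci b R (b i) (b i)

/-- `Σ_i ⟪v, e_i⟫ f(e_i) = f(v)` for linear `f`. -/
theorem aux_expand {V : Type*} [NormedAddCommGroup V] [InnerProductSpace ℝ V]
    {ι : Type*} [Fintype ι] (b : OrthonormalBasis ι ℝ V) (f : V →ₗ[ℝ] ℝ) (v : V) :
    ∑ i, ⟪v, b i⟫ * f (b i) = f v := by
  conv_rhs => rw [← b.sum_repr' v]
  simp [real_inner_comm]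

/-- The trace of a bilinear form is invariant under the isometry `J`. -/
theorem aux_trace {V : Type*} [NormedAddCommGroup V] [InnerProductSpace ℝ V]
    {ι : Type*} [Fintype ι] (b : OrthonormalBasis ι ℝ V) (J : V →ₗ[ℝ] V)
    (hJ2 : ∀ X : V, J (J X) = -X)
    (hJiso : ∀ X Y : V, ⟪J X, J Y⟫ = ⟪X, Y⟫) (B : V →ₗ[ℝ] V →ₗ[ℝ] ℝ) :
    ∑ i, B (J (b i)) (J (b i)) = ∑ i, B (b i) (b i) := by
  have h1 : ∀ i, B (J (b i)) (J (b i)) = ∑ k, ⟪J (b i), b k⟫ * B (b k) (J (b i)) := fun i =>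
    (aux_expand b (B.flip (J (b i))) (J (b i))).symm
  have h2 : ∀ k, B (b k) (b k) = ∑ i, ⟪J (b i), b k⟫ * B (b k) (J (b i)) := by
    intro k
    have h := aux_expand b ((B (b k)).comp J) (J (b k))
    have hs : ∀ i, ⟪J (b k), b i⟫ = - ⟪J (b i), b k⟫ := by
      intro i
      rw [← hJiso (J (b k)) (b i), hJ2, inner_neg_left, real_inner_comm]
    simp only [LinearMap.comp_apply, hJ2, map_neg, hs, neg_mul, Finset.sum_neg_distrib] at h
    linarith
  rw [Finset.sum_congr rfl (fun i _ => h1 i), Finset.sum_congr rfl (fun i _ => h2 i),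
    Finset.sum_comm]

/-- if an algebraic curvature tensor `R` on a `2n`-dimensional
almost Hermitian inner product space (`n ≥ 2`) has constant antiholomorphic sectional
curvature `ν`, then `ρ*(R + L₃R) = (2(n+1)/3)·ρ(R) − (((n+1)τ(R) − 3τ*(R))/(3n))·g`,
where `L₃R(X,Y,Z,W) = R(JX,JY,JZ,JW)`. -/
theorem rhoStar_add_L3_eq
    {V : Type*} [NormedAddCommGroup V] [InnerProductSpace ℝ V]
    [FiniteDimensional ℝ V] (n : ℕ) (hn : 2 ≤ n)
    (hdim : Module.finrank ℝ V = 2 * n)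
    (b : OrthonormalBasis (Fin (2 * n)) ℝ V)
    (J : V →ₗ[ℝ] V)
    (hJ2 : ∀ X : V, J (J X) = -X)
    (hJiso : ∀ X Y : V, ⟪J X, J Y⟫ = ⟪X, Y⟫)
    (R : V →ₗ[ℝ] V →ₗ[ℝ] V →ₗ[ℝ] V →ₗ[ℝ] ℝ)
    (hR1 : ∀ X Y Z W : V, R X Y Z W = - R Y X Z W)
    (hR2 : ∀ X Y Z W : V, R X Y Z W = - R X Y W Z)
    (hR3 : ∀ X Y Z W : V, R X Y Z W = R Z W X Y)
    (hBianchi : ∀ X Y Z W : V, R X Y Z W + R Y Z X W + R Z X Y W = 0)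
    (ν : ℝ)
    (hcasc : ∀ X Y : V, ⟪X, X⟫ = 1 → ⟪Y, Y⟫ = 1 → ⟪X, Y⟫ = 0 → ⟪X, J Y⟫ = 0 →
        R X Y X Y = ν) :
    ∀ X Y : V,
      rhoStar b J
          (fun a b' c d => R a b' c d + R (J a) (J b') (J c) (J d)) X Y =
        (2 * ((n : ℝ) + 1) / 3) * ricci b (fun a b' c d => R a b' c d) X Y -
          ((((n : ℝ) + 1) * scalarCurv b (fun a b' c d => R a b' c d) -
              3 * tauStar b J (fun a b' c d => R a b' c d)) / (3 * (n : ℝ))) *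
            ⟪X, Y⟫ := by
  have htr : ∀ f : V → V → ℝ, (∀ x y z, f (x + y) z = f x z + f y z) →
      (∀ (c : ℝ) x z, f (c • x) z = c * f x z) → (∀ x y z, f x (y + z) = f x y + f x z) →
      (∀ (c : ℝ) x z, f x (c • z) = c * f x z) →
      ∑ i, f (J (b i)) (J (b i)) = ∑ i, f (b i) (b i) := by
    intro f h1 h2 h3 h4
    exact aux_trace b J hJ2 hJiso
      (LinearMap.mk₂ ℝ f h1 (by simpa using h2) h3 (by simpa using h4))
  have hsk : ∀ X : V, ⟪J X, X⟫ = 0 := by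
    intro X
    have := hJiso (J X) X
    rw [hJ2, inner_neg_left, real_inner_comm] at this
    linarith
  have hsk2 : ∀ X : V, ⟪X, J X⟫ = 0 := by
    intro X
    rw [real_inner_comm]
    exact hsk X
  have hxx0 : ∀ X Z W : V, R X X Z W = 0 := by
    intro X Z W
    have := hR1 X X Z W
    linarith
  have hxx1 : ∀ X Z W : V, R Z W X X = 0 := by
    intro X Z W
    have := hR2 Z W X X
    linarith
  have hsub : ∀ X A Y Z W : V, R (X - A) Y Z W = R X Y Z W - R A Y Z W := by
    intro X A Y Z W
    rw [hR1, hR1 X, hR1 A, map_sub, LinearMap.sub_apply, LinearMap.sub_apply]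
    ring
  have hneg : ∀ X Y Z W : V, R (-X) Y Z W = - R X Y Z W := by
    intro X Y Z W
    have := hsub 0 X Y Z W
    simpa using this
  -- the curvature of a general plane with `⟪J X, Y⟫ = 0`
  have hT : ∀ X Y : V, ⟪J X, Y⟫ = 0 →
      R X Y X Y = ν * (⟪X, X⟫ * ⟪Y, Y⟫ - ⟪X, Y⟫ ^ 2) := by
    intro X Y hXY
    by_cases hX : X = 0
    · simp [hX]
    have hXp : 0 < ⟪X, X⟫ := real_inner_self_pos.2 hX
    -- Gram-Schmidt without denominators
    obtain ⟨Z, hZ⟩ : ∃ Z, Z = ⟪X, X⟫ • Y - ⟪X, Y⟫ • X := ⟨_, rfl⟩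
    have hXZ : ⟪X, Z⟫ = 0 := by
      rw [hZ, inner_sub_right, inner_smul_right, inner_smul_right]
      ring
    have hJXZ : ⟪X, J Z⟫ = 0 := by
      have h := hJiso X (J Z)
      rw [hJ2, inner_neg_right] at h
      rw [← h, hZ, inner_sub_right, inner_smul_right, inner_smul_right, hXY, hsk]
      ring
    have hZZ : ⟪Z, Z⟫ = ⟪X, X⟫ * (⟪X, X⟫ * ⟪Y, Y⟫ - ⟪X, Y⟫ ^ 2) := by
      rw [hZ]
      simp only [inner_sub_right, inner_smul_right, inner_sub_left, inner_smul_left,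
        real_inner_comm X Y]
      simp
      ring
    have hRZ : R X Z X Z = ⟪X, X⟫ ^ 2 * R X Y X Y := by
      rw [hZ]
      simp [hxx0, hxx1]
      ring
    have key : R X Z X Z = ν * (⟪X, X⟫ * ⟪Z, Z⟫) := by
      by_cases hZ0 : Z = 0
      · simp [hZ0]
      have hZp : 0 < ⟪Z, Z⟫ := real_inner_self_pos.2 hZ0
      have hx : (√⟪X, X⟫)⁻¹ * (√⟪X, X⟫)⁻¹ * ⟪X, X⟫ = 1 := by
        rw [← mul_inv, Real.mul_self_sqrt hXp.le, inv_mul_cancel₀ hXp.ne']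
      have hz : (√⟪Z, Z⟫)⁻¹ * (√⟪Z, Z⟫)⁻¹ * ⟪Z, Z⟫ = 1 := by
        rw [← mul_inv, Real.mul_self_sqrt hZp.le, inv_mul_cancel₀ hZp.ne']
      generalize (√⟪X, X⟫)⁻¹ = s at hx
      generalize (√⟪Z, Z⟫)⁻¹ = t at hz
      have h := hcasc (s • X) (t • Z)
        (by rw [inner_smul_left, inner_smul_right, ← hx]; simp; ring)
        (by rw [inner_smul_left, inner_smul_right, ← hz]; simp; ring)
        (by rw [inner_smul_left, inner_smul_right, hXZ]; simp)
        (by rw [map_smul, inner_smul_left, inner_smul_right, hJXZ]; simp)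
      simp only [map_smul, LinearMap.smul_apply, smul_eq_mul] at h
      calc R X Z X Z = (s * s * ⟪X, X⟫) * (t * t * ⟪Z, Z⟫) * R X Z X Z := by
            rw [hx, hz]; ring
        _ = (s * (t * (s * (t * R X Z X Z)))) * (⟪X, X⟫ * ⟪Z, Z⟫) := by ring
        _ = ν * (⟪X, X⟫ * ⟪Z, Z⟫) := by rw [← h]; ring
    rw [hRZ, hZZ] at key
    have h2 : ⟪X, X⟫ ^ 2 ≠ 0 := by positivity
    apply mul_left_cancel₀ h2
    rw [key]
    ring
  have hcard : ∑ i, ⟪b i, b i⟫ = 2 * (n : ℝ) := by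
    simp
  have hpars : ∀ X Y : V, ∑ i, ⟪X, b i⟫ * ⟪Y, b i⟫ = ⟪X, Y⟫ := by
    intro X Y
    have := aux_expand b (innerₗ V Y) X
    simp only [innerₗ_apply_apply] at this
    rw [this, real_inner_comm]
  -- holomorphic sectional curvature
  have hH : ∀ X : V, R X (J X) X (J X) = ⟪X, X⟫ * (∑ i, R (b i) X (b i) X)
      - ν * (2 * n - 2) * ⟪X, X⟫ ^ 2 := by
    intro X
    by_cases hX : X = 0
    · simp [hX]
    have hXp : 0 < ⟪X, X⟫ := real_inner_self_pos.2 hX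
    have hi : ∀ i, ⟪X, X⟫ ^ 2 * R X (b i) X (b i)
        - ⟪X, X⟫ * (⟪J X, b i⟫ * R X (J X) X (b i))
        - ⟪X, X⟫ * (⟪J X, b i⟫ * R X (b i) X (J X))
        + ⟪J X, b i⟫ * ⟪J X, b i⟫ * R X (J X) X (J X)
        = ν * (⟪X, X⟫ * (⟪X, X⟫ ^ 2 * ⟪b i, b i⟫ - ⟪X, X⟫ * (⟪J X, b i⟫ * ⟪J X, b i⟫))
          - ⟪X, X⟫ ^ 2 * (⟪X, b i⟫ * ⟪X, b i⟫)) := by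
      intro i
      have h := hT X (⟪X, X⟫ • b i - ⟪J X, b i⟫ • J X) (by
        rw [inner_sub_right, inner_smul_right, inner_smul_right, hJiso]; ring)
      have e1 : ⟪X, ⟪X, X⟫ • b i - ⟪J X, b i⟫ • J X⟫ = ⟪X, X⟫ * ⟪X, b i⟫ := by
        rw [inner_sub_right, inner_smul_right, inner_smul_right, hsk2]; ring
      have e2 : ⟪⟪X, X⟫ • b i - ⟪J X, b i⟫ • J X, ⟪X, X⟫ • b i - ⟪J X, b i⟫ • J X⟫
          = ⟪X, X⟫ ^ 2 * ⟪b i, b i⟫ - ⟪X, X⟫ * (⟪J X, b i⟫ * ⟪J X, b i⟫) := by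
        rw [inner_sub_left, inner_sub_right, inner_sub_right]
        simp only [inner_smul_left, inner_smul_right, hJiso, real_inner_comm (J X) (b i),
          RCLike.conj_to_real]
        ring
      rw [e1, e2] at h
      simp only [map_sub, map_smul, LinearMap.sub_apply, LinearMap.smul_apply, smul_eq_mul] at h
      linear_combination h
    have hs := Finset.sum_congr (rfl : (Finset.univ : Finset (Fin (2 * n))) = _)
      (fun i _ => hi i)
    simp only [Finset.sum_add_distrib, Finset.sum_sub_distrib, ← Finset.mul_sum,
      ← Finset.sum_mul, hpars, hcard, hJiso] at hs
    have t1 := aux_expand b (R X (J X) X) (J X)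
    have t2 : ∑ i, ⟪J X, b i⟫ * R X (b i) X (J X) = R X (J X) X (J X) := by
      rw [← t1]
      exact Finset.sum_congr rfl (fun i _ => by rw [hR3 X (b i) X (J X)])
    have t3 : ∑ i, R (b i) X (b i) X = ∑ i, R X (b i) X (b i) :=
      Finset.sum_congr rfl (fun i _ => by rw [hR1, hR2]; ring)
    rw [t1, t2] at hs
    rw [t3]
    apply mul_left_cancel₀ hXp.ne'
    linear_combination -hs
  -- the Ricci tensor is `J`-invariant
  have hrJ : ∀ X : V, ∑ i, R (b i) (J X) (b i) (J X) = ∑ i, R (b i) X (b i) X := by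
    intro X
    by_cases hX : X = 0
    · simp [hX]
    have hXp : 0 < ⟪X, X⟫ := real_inner_self_pos.2 hX
    have h1 := hH X
    have h2 := hH (J X)
    have h3 : R (J X) (J (J X)) (J X) (J (J X)) = R X (J X) X (J X) := by
      rw [hJ2, hR1, hR2]
      simp [hneg]
    rw [h3, hJiso] at h2
    apply mul_left_cancel₀ hXp.ne'
    linarith
  obtain ⟨τ, hτ⟩ : ∃ τ, τ = ∑ j, ∑ i, R (b i) (b j) (b i) (b j) := ⟨_, rfl⟩
  -- the diagonal identity
  have hdiag : ∀ X : V, 6 * ∑ i, R (b i) X (J (b i)) (J X) = ⟪X, X⟫ * τ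
      + (2 * n + 2) * (∑ i, R (b i) X (b i) X) - 8 * ν * (n - 1) * (n + 1) * ⟪X, X⟫ := by
    intro X
    have hpt : ∀ e : V, 2 * R e (J e) X (J X) + R e (J X) e (J X) + 2 * R e (J X) X (J e)
        + R X (J e) X (J e) = ⟪X, X⟫ * (∑ i, R (b i) e (b i) e)
          + 2 * (⟪X, e⟫ * ((∑ i, R (b i) X (b i) e) + ∑ i, R (b i) e (b i) X))
          + ⟪e, e⟫ * (∑ i, R (b i) X (b i) X)
          - ν * (2 * n - 2) * (2 * ⟪X, X⟫ * ⟪e, e⟫ + 4 * (⟪X, e⟫ * ⟪X, e⟫)) := by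
      intro e
      have h1 := hH (X + e)
      have h2 := hH (X - e)
      have h3 := hH X
      have h4 := hH e
      simp only [map_add, map_sub, LinearMap.add_apply, LinearMap.sub_apply, hsub,
        Finset.sum_add_distrib, Finset.sum_sub_distrib, inner_add_left, inner_add_right,
        inner_sub_left, inner_sub_right, real_inner_comm X e] at h1 h2
      have s1 := hR3 e (J e) X (J X)
      have s2 := hR3 e (J X) X (J e)
      linear_combination (h1 + h2) / 2 - h3 - h4 + s1 + s2
    have hs := Finset.sum_congr (rfl : (Finset.univ : Finset (Fin (2 * n))) = _)
      (fun i _ => hpt (b i))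
    simp only [Finset.sum_add_distrib, Finset.sum_sub_distrib, ← Finset.mul_sum,
      ← Finset.sum_mul, hpars, hcard, ← hτ, mul_add] at hs
    have u1 : ∑ j, ⟪X, b j⟫ * ∑ i, R (b i) X (b i) (b j) = ∑ i, R (b i) X (b i) X := by
      have := aux_expand b (∑ i, R (b i) X (b i)) X
      simpa [LinearMap.sum_apply] using this
    have u2 : ∑ j, ⟪X, b j⟫ * ∑ i, R (b i) (b j) (b i) X = ∑ i, R (b i) X (b i) X := by
      rw [← u1]
      refine Finset.sum_congr rfl (fun j _ => ?_)
      congr 1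
      exact Finset.sum_congr rfl (fun i _ => hR3 _ _ _ _)
    have u3 : ∑ i, R X (J (b i)) X (J (b i)) = ∑ i, R (b i) X (b i) X := by
      rw [htr (fun x y => R X x X y) (by simp) (by simp) (by simp) (by simp)]
      exact Finset.sum_congr rfl (fun i _ => by rw [hR1, hR2]; ring)
    have u4 : ∑ i, R (b i) (J X) X (J (b i)) = ∑ i, R (b i) X (J (b i)) (J X) := by
      rw [← htr (fun x y => R x (J X) X (J y)) (by simp) (by simp) (by simp) (by simp)]
      refine Finset.sum_congr rfl (fun i _ => ?_)
      simp only [hJ2, map_neg]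
      rw [hR3, hR1]
      ring
    have u5 : ∑ i, R (b i) (J (b i)) X (J X) = 2 * ∑ i, R (b i) X (J (b i)) (J X) := by
      have v : ∑ i, R (J (b i)) X (b i) (J X) = - ∑ i, R (b i) X (J (b i)) (J X) := by
        rw [← htr (fun x y => R x X (J y) (J X)) (by simp) (by simp) (by simp) (by simp),
          ← Finset.sum_neg_distrib]
        refine Finset.sum_congr rfl (fun i _ => ?_)
        simp [hJ2]
      have w : ∀ i, R (b i) (J (b i)) X (J X)
          = R (b i) X (J (b i)) (J X) - R (J (b i)) X (b i) (J X) := by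
        intro i
        have := hBianchi (b i) (J (b i)) X (J X)
        have := hR1 X (b i) (J (b i)) (J X)
        linarith
      rw [Finset.sum_congr rfl (fun i _ => w i), Finset.sum_sub_distrib, v]
      ring
    rw [u1, u2, u3, u4, u5, hrJ] at hs
    linear_combination hs
  obtain ⟨σ, hσ⟩ : ∃ σ, σ = ∑ j, ∑ i, R (b i) (b j) (J (b i)) (J (b j)) := ⟨_, rfl⟩
  have htrace : 6 * σ = (4 * n + 2) * τ - 16 * n * ν * (n - 1) * (n + 1) := by
    have hs := Finset.sum_congr (rfl : (Finset.univ : Finset (Fin (2 * n))) = _)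
      (fun i _ => hdiag (b i))
    simp only [Finset.sum_add_distrib, Finset.sum_sub_distrib, ← Finset.mul_sum,
      ← Finset.sum_mul, hcard, ← hτ, ← hσ] at hs
    linear_combination hs
  intro X Y
  have hn0 : (n : ℝ) ≠ 0 := by
    have : 0 < n := by omega
    positivity
  have hL : ∑ i, R (J (b i)) (J X) (J (J (b i))) (J (J Y))
      = ∑ i, R (b i) Y (J (b i)) (J X) := by
    refine Finset.sum_congr rfl (fun i _ => ?_)
    simp only [hJ2, map_neg, LinearMap.neg_apply, neg_neg]
    rw [hR3]
  have hsym : ∑ i, R (b i) Y (b i) X = ∑ i, R (b i) X (b i) Y :=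
    Finset.sum_congr rfl (fun i _ => hR3 _ _ _ _)
  have d1 := hdiag (X + Y)
  have d2 := hdiag X
  have d3 := hdiag Y
  simp only [map_add, LinearMap.add_apply, Finset.sum_add_distrib, inner_add_left,
    inner_add_right, real_inner_comm X Y, hsym] at d1
  simp only [rhoStar, ricci, scalarCurv, tauStar, Finset.sum_add_distrib, hL, ← hτ, ← hσ]
  field_simp
  linear_combination (n : ℝ) * (d1 - d2 - d3) / 2 - ⟪X, Y⟫ * htrace / 2
end

section
/- Let V be a real inner product space of dimension 2n with n ≥ 2, with inner product g and a linear isometry J : V → V satisfying J∘J = −id, and let R be an algebraic curvature tensor on V with constant antiholomorphic sectional curvature ν. Then 8n(n² − 1)ν = (2n+1)τ(R) − 3τ*(R). -/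
open scoped RealInnerProductSpace BigOperators

theorem sum_J_swap {V : Type*} [NormedAddCommGroup V] [InnerProductSpace ℝ V]
    {ι : Type*} [Fintype ι] (b : OrthonormalBasis ι ℝ V) (J : V →ₗ[ℝ] V)
    (hJs : ∀ X Y : V, ⟪X, J Y⟫ = - ⟪J X, Y⟫)
    (B : V →ₗ[ℝ] V →ₗ[ℝ] ℝ) :
    ∑ i, B (J (b i)) (b i) = - ∑ i, B (b i) (J (b i)) := by
  have h1 : ∀ i, B (J (b i)) (b i) = ∑ k, ⟪b k, J (b i)⟫ * B (b k) (b i) := by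
    intro i
    conv_lhs => rw [← b.sum_repr' (J (b i))]
    simp
  have h2 : ∀ i, B (b i) (J (b i)) = ∑ k, ⟪b k, J (b i)⟫ * B (b i) (b k) := by
    intro i
    conv_lhs => rw [← b.sum_repr' (J (b i))]
    simp
  simp_rw [h1, h2]
  rw [Finset.sum_comm, ← Finset.sum_neg_distrib]
  refine Finset.sum_congr rfl fun i _ => ?_
  rw [← Finset.sum_neg_distrib]
  refine Finset.sum_congr rfl fun k _ => ?_
  rw [hJs, real_inner_comm]
  ring

theorem scaled_casc {V : Type*} [NormedAddCommGroup V] [InnerProductSpace ℝ V]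
    (J : V →ₗ[ℝ] V)
    (R : V →ₗ[ℝ] V →ₗ[ℝ] V →ₗ[ℝ] V →ₗ[ℝ] ℝ) (ν : ℝ)
    (hcasc : ∀ X Y : V, ⟪X, X⟫ = 1 → ⟪Y, Y⟫ = 1 → ⟪X, Y⟫ = 0 → ⟪X, J Y⟫ = 0 →
        R X Y X Y = ν) (X Y : V) (h1 : ⟪X, Y⟫ = 0) (h2 : ⟪X, J Y⟫ = 0) :
    R X Y X Y = ν * ⟪X, X⟫ * ⟪Y, Y⟫ := by
  by_cases hX : X = 0
  · simp [hX]
  by_cases hY : Y = 0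
  · simp [hY]
  have hx : ‖X‖ ≠ 0 := norm_ne_zero_iff.2 hX
  have hy : ‖Y‖ ≠ 0 := norm_ne_zero_iff.2 hY
  have := hcasc (‖X‖⁻¹ • X) (‖Y‖⁻¹ • Y)
    (by simp only [real_inner_smul_left, real_inner_smul_right]
        rw [real_inner_self_eq_norm_sq]
        field_simp)
    (by simp only [real_inner_smul_left, real_inner_smul_right]
        rw [real_inner_self_eq_norm_sq]
        field_simp)
    (by simp [real_inner_smul_left, real_inner_smul_right, h1])
    (by simp [real_inner_smul_left, real_inner_smul_right, h2])
  simp only [map_smul, LinearMap.smul_apply, smul_eq_mul] at this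
  rw [real_inner_self_eq_norm_sq, real_inner_self_eq_norm_sq, ← this]
  field_simp

/-- if an algebraic curvature tensor `R` on a `2n`-dimensional
almost Hermitian inner product space (`n ≥ 2`) has constant antiholomorphic sectional
curvature `ν`, then `8n(n² − 1)ν = (2n+1)τ(R) − 3τ*(R)`. -/
theorem eight_n_nsq_sub_one_nu_eq
    {V : Type*} [NormedAddCommGroup V] [InnerProductSpace ℝ V]
    [FiniteDimensional ℝ V] (n : ℕ) (hn : 2 ≤ n)
    (hdim : Module.finrank ℝ V = 2 * n)
    (b : OrthonormalBasis (Fin (2 * n)) ℝ V)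
    (J : V →ₗ[ℝ] V)
    (hJ2 : ∀ X : V, J (J X) = -X)
    (hJiso : ∀ X Y : V, ⟪J X, J Y⟫ = ⟪X, Y⟫)
    (R : V →ₗ[ℝ] V →ₗ[ℝ] V →ₗ[ℝ] V →ₗ[ℝ] ℝ)
    (hR1 : ∀ X Y Z W : V, R X Y Z W = - R Y X Z W)
    (hR2 : ∀ X Y Z W : V, R X Y Z W = - R X Y W Z)
    (hR3 : ∀ X Y Z W : V, R X Y Z W = R Z W X Y)
    (hBianchi : ∀ X Y Z W : V, R X Y Z W + R Y Z X W + R Z X Y W = 0)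
    (ν : ℝ)
    (hcasc : ∀ X Y : V, ⟪X, X⟫ = 1 → ⟪Y, Y⟫ = 1 → ⟪X, Y⟫ = 0 → ⟪X, J Y⟫ = 0 →
        R X Y X Y = ν) :
    8 * (n : ℝ) * ((n : ℝ) ^ 2 - 1) * ν =
      (2 * (n : ℝ) + 1) * scalarCurv b (fun a b' c d => R a b' c d) -
        3 * tauStar b J (fun a b' c d => R a b' c d) := by
  have hJs : ∀ X Y : V, ⟪X, J Y⟫ = - ⟪J X, Y⟫ := by
    intro X Y
    rw [← hJiso X (J Y), hJ2, inner_neg_right]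
  have hXJX : ∀ X : V, ⟪X, J X⟫ = 0 := by
    intro X
    have := hJs X X
    rw [real_inner_comm X (J X)] at this
    linarith
  have hdiag0 : ∀ X Z W : V, R X X Z W = 0 := fun X Z W => by linarith [hR1 X X Z W]
  have hdiag1 : ∀ X Z W : V, R Z W X X = 0 := fun X Z W => by linarith [hR2 Z W X X]
  -- pointwise identity
  have hpt : ∀ X Y : V, ⟪X, X⟫ * ⟪X, X⟫ * R X Y X Y
      - 2 * ⟪X, X⟫ * (⟪J X, Y⟫ * R X Y X (J X))
      + R X (J X) X (J X) * (⟪J X, Y⟫ * ⟪J X, Y⟫) =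
      ν * ⟪X, X⟫ * (⟪X, X⟫ * ⟪X, X⟫ * ⟪Y, Y⟫
        - ⟪X, X⟫ * (⟪X, Y⟫ * ⟪X, Y⟫ + ⟪J X, Y⟫ * ⟪J X, Y⟫)) := by
    intro X Y
    have hJX : ⟪J X, X⟫ = 0 := by rw [real_inner_comm]; exact hXJX X
    have key := scaled_casc J R ν hcasc X (⟪X, X⟫ • Y - ⟪X, Y⟫ • X - ⟪J X, Y⟫ • J X)
      (by simp only [inner_sub_right, real_inner_smul_right, hXJX]; ring)
      (by
        simp only [map_sub, map_smul, inner_sub_right, real_inner_smul_right, hXJX, hJ2,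
          inner_neg_right, hJs X Y]; ring)
    have e1 : ⟪Y, X⟫ = ⟪X, Y⟫ := real_inner_comm _ _
    have e2 : ⟪Y, J X⟫ = ⟪J X, Y⟫ := real_inner_comm _ _
    have e3 : R X (J X) X Y = R X Y X (J X) := hR3 _ _ _ _
    simp only [map_sub, map_smul, LinearMap.sub_apply, LinearMap.smul_apply, smul_eq_mul,
      inner_sub_left, inner_sub_right, real_inner_smul_left, real_inner_smul_right, hXJX, hJX,
      hJiso, hdiag0, hdiag1, e1, e2, e3] at key
    linear_combination key
  -- trace over Y
  have htr : ∀ X : V, ⟪X, X⟫ * (∑ k, R (b k) X (b k) X) - R X (J X) X (J X) =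
      ν * (2 * n - 2) * ⟪X, X⟫ * ⟪X, X⟫ := by
    intro X
    by_cases hX : X = 0
    · simp [hX]
    have hq : ⟪X, X⟫ ≠ 0 := inner_self_ne_zero.2 hX
    have hs := Finset.sum_congr (rfl : (Finset.univ : Finset (Fin (2 * n))) = Finset.univ)
      (fun k _ => hpt X (b k))
    have s1 : ∑ k, R X (b k) X (b k) = ∑ k, R (b k) X (b k) X :=
      Finset.sum_congr rfl fun k _ => by rw [hR1, hR2, neg_neg]
    have s2 : ∀ Z : V, ∑ k, ⟪Z, b k⟫ * ⟪Z, b k⟫ = ⟪Z, Z⟫ := by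
      intro Z
      rw [← b.sum_inner_mul_inner Z Z]
      exact Finset.sum_congr rfl fun k _ => by rw [real_inner_comm (b k) Z]
    have s3 : ∑ k, ⟪J X, b k⟫ * R X (b k) X (J X) = R X (J X) X (J X) := by
      conv_rhs => rw [show R X (J X) = R X (∑ k, ⟪b k, J X⟫ • b k) by rw [b.sum_repr']]
      simp only [map_sum, map_smul, LinearMap.sum_apply, LinearMap.smul_apply, smul_eq_mul]
      exact Finset.sum_congr rfl fun k _ => by rw [real_inner_comm]
    have s4 : ∑ k, ⟪b k, b k⟫ = 2 * (n : ℝ) := by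
      simp
    simp only [Finset.sum_add_distrib, Finset.sum_sub_distrib, ← Finset.mul_sum,
      ← Finset.sum_mul, mul_assoc, s1, s2, s3, s4, hJiso] at hs
    apply mul_left_cancel₀ hq
    linear_combination hs
  -- polarization
  have hpol : ∀ x y : V, ⟪x, x⟫ * (∑ k, R (b k) y (b k) y) + ⟪y, y⟫ * (∑ k, R (b k) x (b k) x)
      + 4 * (⟪x, y⟫ * ∑ k, R (b k) x (b k) y)
      - (2 * R x (J x) y (J y) + R x (J y) x (J y) + R y (J x) y (J x) + 2 * R x (J y) y (J x))
      = ν * (2 * n - 2) * (2 * ⟪x, x⟫ * ⟪y, y⟫ + 4 * (⟪x, y⟫ * ⟪x, y⟫)) := by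
    intro x y
    have h1 := htr (x + y)
    have h2 := htr (x - y)
    have h3 := htr x
    have h4 := htr y
    have e1 : ⟪y, x⟫ = ⟪x, y⟫ := real_inner_comm _ _
    have e2 : ∑ k, R (b k) y (b k) x = ∑ k, R (b k) x (b k) y :=
      Finset.sum_congr rfl fun k _ => hR3 _ _ _ _
    have e3 : R y (J y) x (J x) = R x (J x) y (J y) := hR3 _ _ _ _
    have e4 : R y (J x) x (J y) = R x (J y) y (J x) := hR3 _ _ _ _
    have hRsub : ∀ Z W U : V, R (x - y) Z W U = R x Z W U - R y Z W U := by
      intro Z W U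
      have h : R (x - y + y) Z W U = R (x - y) Z W U + R y Z W U := by
        rw [map_add]; rfl
      rw [sub_add_cancel] at h
      linarith
    simp only [map_add, hRsub, map_sub, LinearMap.add_apply, LinearMap.sub_apply, inner_add_left,
      inner_add_right, inner_sub_left, inner_sub_right, Finset.sum_add_distrib,
      Finset.sum_sub_distrib, e1, e2, e3, e4] at h1 h2
    linear_combination (h1 + h2) / 2 - h3 - h4
  have hsum := Finset.sum_congr (rfl : (Finset.univ : Finset (Fin (2 * n))) = Finset.univ)
      (fun i _ => Finset.sum_congr (rfl : (Finset.univ : Finset (Fin (2 * n))) = Finset.univ)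
      (fun j _ => hpol (b i) (b j)))
  -- traces
  have hJJ : ∀ B : V →ₗ[ℝ] V →ₗ[ℝ] ℝ, ∑ i, B (J (b i)) (J (b i)) = ∑ i, B (b i) (b i) := by
    intro B
    have := sum_J_swap b J hJs (B.compl₂ J)
    simpa [hJ2] using this
  have t1 : ∑ i, ∑ j, R (b i) (J (b j)) (b i) (J (b j)) = ∑ i, ∑ j, R (b j) (b i) (b j) (b i) := by
    refine Finset.sum_congr rfl fun i _ => ?_
    have := hJJ ((R (b i)).flip (b i))
    simp only [LinearMap.flip_apply] at this
    rw [this]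
    exact Finset.sum_congr rfl fun j _ => by rw [hR1, hR2, neg_neg]
  have t1' : ∑ i, ∑ j, R (b j) (J (b i)) (b j) (J (b i)) = ∑ i, ∑ j, R (b j) (b i) (b j) (b i) := by
    rw [Finset.sum_comm, t1]
  have t2 : ∑ i, ∑ j, R (b i) (J (b j)) (b j) (J (b i)) =
      ∑ i, ∑ j, R (b j) (b i) (J (b j)) (J (b i)) := by
    refine Finset.sum_congr rfl fun i _ => ?_
    have := sum_J_swap b J hJs (LinearMap.mk₂ ℝ (fun u v => R (b i) u v (J (b i)))
      (by intros; simp) (by intros; simp) (by intros; simp) (by intros; simp))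
    simp only [LinearMap.mk₂_apply] at this
    rw [this, ← Finset.sum_neg_distrib]
    exact Finset.sum_congr rfl fun j _ => by rw [hR1, neg_neg]
  have t3 : ∑ i, ∑ j, R (b i) (J (b i)) (b j) (J (b j)) =
      2 * ∑ i, ∑ j, R (b j) (b i) (J (b j)) (J (b i)) := by
    refine Eq.trans ?_ (two_mul _).symm
    refine Eq.trans ?_ (congrArg (· + _) t2)
    simp only [← Finset.sum_add_distrib]
    refine Finset.sum_congr rfl fun i _ => Finset.sum_congr rfl fun j _ => ?_
    have a1 := hBianchi (b i) (J (b i)) (b j) (J (b j))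
    have a2 := hR1 (J (b i)) (b j) (b i) (J (b j))
    have a3 := hR3 (b j) (J (b i)) (b i) (J (b j))
    have a4 := hR2 (b j) (b i) (J (b i)) (J (b j))
    linarith
  have g1 : ∀ i, ⟪b i, b i⟫ = (1 : ℝ) := fun i => by simp
  have g2 : ∀ (i) (f : Fin (2 * n) → ℝ), ∑ j, ⟪b i, b j⟫ * f j = f i := by
    intro i f
    simp [b.inner_eq_ite]
  simp only [scalarCurv, tauStar, ricci, rhoStar]
  simp only [Finset.sum_add_distrib, Finset.sum_sub_distrib, ← Finset.mul_sum, g1, g2, one_mul,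
    t1, t1', t2, t3, mul_one, Finset.sum_const, Finset.card_univ, Fintype.card_fin,
    nsmul_eq_mul] at hsum
  push_cast at hsum
  linear_combination -hsum / 2
end

section
/- Let V be a real inner product space of dimension 2n with n ≥ 2, with inner product g and a linear isometry J : V → V satisfying J∘J = −id, and let R be an algebraic curvature tensor on V with constant antiholomorphic sectional curvature ν. Define the bilinear form Q = (1/6)·ρ(R) + (1/(4(n+1)))·ρ*(R − L₃R). Then Q(JX,JY) = Q(Y,X) for all X,Y ∈ V. -/
open scoped RealInnerProductSpace BigOperators

/-- The tensor `Q = (1/6)·ρ(R) + (1/(4(n+1)))·ρ*(R − L₃R)`,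
where `L₃R(X,Y,Z,W) = R(JX,JY,JZ,JW)`. -/
noncomputable def qTensor {V : Type*} [NormedAddCommGroup V] [InnerProductSpace ℝ V]
    {ι : Type*} [Fintype ι] (n : ℕ) (b : OrthonormalBasis ι ℝ V) (J : V →ₗ[ℝ] V)
    (R : V → V → V → V → ℝ) (X Y : V) : ℝ :=
  (1 / 6) * ricci b R X Y +
    (1 / (4 * ((n : ℝ) + 1))) *
      rhoStar b J (fun a b' c d => R a b' c d - R (J a) (J b') (J c) (J d)) X Y

theorem aux_flip {V : Type*} [NormedAddCommGroup V] [InnerProductSpace ℝ V]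
    {ι : Type*} [Fintype ι] (b : OrthonormalBasis ι ℝ V) (J : V →ₗ[ℝ] V)
    (hskew : ∀ X Y : V, ⟪X, J Y⟫ = - ⟪Y, J X⟫)
    (R : V →ₗ[ℝ] V →ₗ[ℝ] V →ₗ[ℝ] V →ₗ[ℝ] ℝ) (A B : V) :
    ∑ i, R (b i) A (J (b i)) B = - ∑ i, R (J (b i)) A (b i) B := by
  have h1 : ∀ i, R (b i) A (J (b i)) B = ∑ j, ⟪b j, J (b i)⟫ * R (b i) A (b j) B := by
    intro i
    conv_lhs => rw [← b.sum_repr' (J (b i))]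
    simp [map_sum, LinearMap.sum_apply]
  have h2 : ∀ i, R (J (b i)) A (b i) B = ∑ j, ⟪b j, J (b i)⟫ * R (b j) A (b i) B := by
    intro i
    conv_lhs => rw [← b.sum_repr' (J (b i))]
    simp [map_sum, LinearMap.sum_apply]
  simp only [h1, h2]
  rw [Finset.sum_comm, ← Finset.sum_neg_distrib]
  refine Finset.sum_congr rfl fun i _ => ?_
  rw [← Finset.sum_neg_distrib]
  refine Finset.sum_congr rfl fun j _ => ?_
  rw [hskew (b i) (b j)]
  ring

theorem aux_sec {V : Type*} [NormedAddCommGroup V] [InnerProductSpace ℝ V]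
    (J : V →ₗ[ℝ] V)
    (R : V →ₗ[ℝ] V →ₗ[ℝ] V →ₗ[ℝ] V →ₗ[ℝ] ℝ)
    (ν : ℝ)
    (hcasc : ∀ X Y : V, ⟪X, X⟫ = 1 → ⟪Y, Y⟫ = 1 → ⟪X, Y⟫ = 0 → ⟪X, J Y⟫ = 0 →
        R X Y X Y = ν) (X Y : V) (hX : ⟪X, X⟫ = 1) (h1 : ⟪Y, X⟫ = 0) (h2 : ⟪Y, J X⟫ = 0) :
    R Y X Y X = ν * ⟪Y, Y⟫ := by
  by_cases hY : Y = 0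
  · simp [hY]
  have hn : ‖Y‖ ≠ 0 := norm_ne_zero_iff.mpr hY
  have h := hcasc ((‖Y‖)⁻¹ • Y) X
    (by rw [real_inner_smul_left, real_inner_smul_right, real_inner_self_eq_norm_sq]
        field_simp) hX
    (by simp [real_inner_smul_left, h1]) (by simp [real_inner_smul_left, h2])
  simp only [map_smul, LinearMap.smul_apply, smul_eq_mul] at h
  rw [real_inner_self_eq_norm_sq, ← h]
  field_simp

theorem aux_ricci {V : Type*} [NormedAddCommGroup V] [InnerProductSpace ℝ V]
    (n : ℕ) (b : OrthonormalBasis (Fin (2 * n)) ℝ V) (J : V →ₗ[ℝ] V)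
    (hskew : ∀ X Y : V, ⟪X, J Y⟫ = - ⟪Y, J X⟫)
    (hJiso : ∀ X Y : V, ⟪J X, J Y⟫ = ⟪X, Y⟫)
    (R : V →ₗ[ℝ] V →ₗ[ℝ] V →ₗ[ℝ] V →ₗ[ℝ] ℝ)
    (hR1 : ∀ X Y Z W : V, R X Y Z W = - R Y X Z W)
    (hR3 : ∀ X Y Z W : V, R X Y Z W = R Z W X Y)
    (ν : ℝ)
    (hcasc : ∀ X Y : V, ⟪X, X⟫ = 1 → ⟪Y, Y⟫ = 1 → ⟪X, Y⟫ = 0 → ⟪X, J Y⟫ = 0 →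
        R X Y X Y = ν) (X : V) (hX : ⟪X, X⟫ = 1) :
    ∑ i, R (b i) X (b i) X = R (J X) X (J X) X + ν * (2 * n - 2) := by
  have hXJ : ⟪X, J X⟫ = 0 := by linarith [hskew X X]
  have hJX : ⟪J X, X⟫ = 0 := by rw [real_inner_comm]; exact hXJ
  have hJJ : ⟪J X, J X⟫ = 1 := by rw [hJiso, hX]
  have hXX : ∀ Z, R X X Z X = 0 := fun Z => by linarith [hR1 X X Z X]
  have hXX' : ∀ Z, R Z X X X = 0 := fun Z => by rw [hR3]; exact hXX Z
  have hsub : ∀ A B C D E, R (A - B) C D E = R A C D E - R B C D E := by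
    intro A B C D E
    rw [hR1, hR1 A, hR1 B]
    simp only [map_sub, LinearMap.sub_apply]
    ring
  have key : ∀ i, R (b i) X (b i) X - 2 * (⟪b i, J X⟫ * R (b i) X (J X) X)
      + ⟪b i, J X⟫ ^ 2 * R (J X) X (J X) X
      = ν * (1 - ⟪b i, X⟫ ^ 2 - ⟪b i, J X⟫ ^ 2) := by
    intro i
    have hb : ⟪b i, b i⟫ = 1 := by simp [b.orthonormal.1 i]
    have h := aux_sec J R ν hcasc X (b i - ⟪b i, X⟫ • X - ⟪b i, J X⟫ • J X) hX
      (by simp only [inner_sub_left, real_inner_smul_left, hX, hJX]; ring)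
      (by simp only [inner_sub_left, real_inner_smul_left, hJJ, hXJ]; ring)
    simp only [inner_sub_left, inner_sub_right, real_inner_smul_left, real_inner_smul_right,
      hsub, map_sub, map_smul, LinearMap.sub_apply, LinearMap.smul_apply, smul_eq_mul, hXX, hXX',
      hX, hJX, hXJ, hJJ, hb, real_inner_comm (b i)] at h
    rw [hR3 (J X) X (b i) X] at h
    linarith
  have hs := Finset.sum_congr (rfl : (Finset.univ : Finset (Fin (2 * n))) = _) fun i _ => key i
  have e1 : ∑ i, ⟪b i, J X⟫ * R (b i) X (J X) X = R (J X) X (J X) X := by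
    have : R (∑ i, ⟪b i, J X⟫ • b i) X (J X) X = R (J X) X (J X) X := by rw [b.sum_repr']
    rw [← this]
    simp [map_sum, LinearMap.sum_apply]
  have e2 : ∀ Z, ⟪Z, Z⟫ = (1 : ℝ) → ∑ i, ⟪b i, Z⟫ ^ 2 = 1 := by
    intro Z hZ
    rw [← hZ, ← b.sum_inner_mul_inner Z Z]
    refine Finset.sum_congr rfl fun i _ => ?_
    rw [real_inner_comm Z (b i)]
    ring
  simp only [Finset.sum_add_distrib, Finset.sum_sub_distrib, ← Finset.mul_sum, ← Finset.sum_mul,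
    e1, e2 X hX, e2 (J X) hJJ] at hs
  simp at hs
  linarith

/-- if an algebraic curvature tensor `R` on a `2n`-dimensional
almost Hermitian inner product space (`n ≥ 2`) has constant antiholomorphic sectional
curvature `ν`, and `Q = (1/6)·ρ(R) + (1/(4(n+1)))·ρ*(R − L₃R)`, then
`Q(JX,JY) = Q(Y,X)` for all `X, Y`. -/
theorem qTensor_hybrid_symmetry
    {V : Type*} [NormedAddCommGroup V] [InnerProductSpace ℝ V]
    [FiniteDimensional ℝ V] (n : ℕ) (hn : 2 ≤ n)
    (hdim : Module.finrank ℝ V = 2 * n)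
    (b : OrthonormalBasis (Fin (2 * n)) ℝ V)
    (J : V →ₗ[ℝ] V)
    (hJ2 : ∀ X : V, J (J X) = -X)
    (hJiso : ∀ X Y : V, ⟪J X, J Y⟫ = ⟪X, Y⟫)
    (R : V →ₗ[ℝ] V →ₗ[ℝ] V →ₗ[ℝ] V →ₗ[ℝ] ℝ)
    (hR1 : ∀ X Y Z W : V, R X Y Z W = - R Y X Z W)
    (hR2 : ∀ X Y Z W : V, R X Y Z W = - R X Y W Z)
    (hR3 : ∀ X Y Z W : V, R X Y Z W = R Z W X Y)
    (hBianchi : ∀ X Y Z W : V, R X Y Z W + R Y Z X W + R Z X Y W = 0)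
    (ν : ℝ)
    (hcasc : ∀ X Y : V, ⟪X, X⟫ = 1 → ⟪Y, Y⟫ = 1 → ⟪X, Y⟫ = 0 → ⟪X, J Y⟫ = 0 →
        R X Y X Y = ν) :
    ∀ X Y : V,
      qTensor n b J (fun a b' c d => R a b' c d) (J X) (J Y) =
        qTensor n b J (fun a b' c d => R a b' c d) Y X := by
  have hskew : ∀ X Y : V, ⟪X, J Y⟫ = - ⟪Y, J X⟫ := by
    intro X Y
    rw [← hJiso X (J Y), hJ2, inner_neg_right, real_inner_comm]
  have hneg : ∀ A C D E, R (-A) C D E = - R A C D E := by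
    intro A C D E
    rw [hR1, hR1 A]
    simp only [map_neg, LinearMap.neg_apply]
  have hunit : ∀ X : V, ⟪X, X⟫ = 1 →
      ∑ i, R (b i) (J X) (b i) (J X) = ∑ i, R (b i) X (b i) X := by
    intro X hX
    rw [aux_ricci n b J hskew hJiso R hR1 hR3 ν hcasc X hX,
      aux_ricci n b J hskew hJiso R hR1 hR3 ν hcasc (J X) (by rw [hJiso, hX]), hJ2]
    simp only [hneg, map_neg, LinearMap.neg_apply]
    rw [hR1 (J X) X, hR2 X (J X) (J X) X]
  have hall : ∀ X : V, ∑ i, R (b i) (J X) (b i) (J X) = ∑ i, R (b i) X (b i) X := by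
    intro X
    by_cases hX : X = 0
    · simp [hX]
    have hn0 : ‖X‖ ≠ 0 := norm_ne_zero_iff.mpr hX
    have h := hunit ((‖X‖)⁻¹ • X) (by
      rw [real_inner_smul_left, real_inner_smul_right, real_inner_self_eq_norm_sq]
      field_simp)
    simp only [map_smul, LinearMap.smul_apply, smul_eq_mul, ← Finset.mul_sum] at h
    have hi : (‖X‖)⁻¹ ≠ 0 := inv_ne_zero hn0
    exact mul_left_cancel₀ hi (mul_left_cancel₀ hi h)
  have hsym : ∀ X Y : V, ∑ i, R (b i) X (b i) Y = ∑ i, R (b i) Y (b i) X :=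
    fun X Y => Finset.sum_congr rfl fun i _ => hR3 _ _ _ _
  intro X Y
  have hric : ∑ i, R (b i) (J X) (b i) (J Y) = ∑ i, R (b i) Y (b i) X := by
    have h := hall (X + Y)
    simp only [map_add, LinearMap.add_apply, Finset.sum_add_distrib] at h
    linarith [hall X, hall Y, hsym X Y, hsym (J X) (J Y)]
  have hst : ∀ A B, ∑ i, R (b i) A (J (b i)) B = - ∑ i, R (J (b i)) A (b i) B :=
    aux_flip b J hskew R
  have hsw : ∀ A B, ∑ i, R (b i) A (J (b i)) B = ∑ i, R (J (b i)) B (b i) A :=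
    fun A B => Finset.sum_congr rfl fun i _ => hR3 _ _ _ _
  unfold qTensor ricci rhoStar
  simp only [hric, hJ2, map_neg, LinearMap.neg_apply, neg_neg, Finset.sum_sub_distrib,
    Finset.sum_neg_distrib]
  congr 2
  linarith [hst X (J Y), hst (J X) Y, hsw X (J Y), hsw (J X) Y, hsw Y (J X), hsw (J Y) X,
    hst Y (J X), hst (J Y) X]
end

section
/- Let V be a real inner product space of dimension 2n with n ≥ 2, with inner product g and a linear isometry J : V → V satisfying J∘J = −id, and let R be an algebraic curvature tensor on V with constant antiholomorphic sectional curvature ν. Define Q = (1/6)·ρ(R) + (1/(4(n+1)))·ρ*(R − L₃R). Then R = ψ(Q) + ν·π₁ − ((2n−1)/3)·ν·π₂. -/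
open scoped RealInnerProductSpace BigOperators

section aux

variable {V : Type*} [NormedAddCommGroup V] [InnerProductSpace ℝ V]

/-- Polarization: a curvature-like map with vanishing sectional curvatures vanishes. -/
theorem aux_polar (F : V → V → V → V → ℝ)
    (hadd1 : ∀ X X' Y Z W, F (X + X') Y Z W = F X Y Z W + F X' Y Z W)
    (h1 : ∀ X Y Z W, F X Y Z W = - F Y X Z W)
    (h3 : ∀ X Y Z W, F X Y Z W = F Z W X Y)
    (hB : ∀ X Y Z W, F X Y Z W + F Y Z X W + F Z X Y W = 0)
    (h0 : ∀ X Y, F X Y X Y = 0) : ∀ X Y Z W, F X Y Z W = 0 := by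
  have hadd2 : ∀ X Y Y' Z W, F X (Y + Y') Z W = F X Y Z W + F X Y' Z W := by
    intro X Y Y' Z W
    rw [h1, hadd1, h1 X Y, h1 X Y']; ring
  have hadd3 : ∀ X Y Z Z' W, F X Y (Z + Z') W = F X Y Z W + F X Y Z' W := by
    intro X Y Z Z' W
    rw [h3, hadd1, h3 X Y Z W, h3 X Y Z' W]
  have hadd4 : ∀ X Y Z W W', F X Y Z (W + W') = F X Y Z W + F X Y Z W' := by
    intro X Y Z W W'
    rw [h3, hadd2, h3 X Y Z W, h3 X Y Z W']
  have a1 : ∀ X Y W, F X Y X W = 0 := by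
    intro X Y W
    have h := h0 X (Y + W)
    rw [hadd2, hadd4, hadd4, h0, h0, h3 X W X Y] at h
    linarith
  have a2 : ∀ X Y Z W, F X Y Z W = F Y Z X W := by
    intro X Y Z W
    have h := a1 (X + Z) Y W
    rw [hadd1, hadd3, hadd3, a1, a1] at h
    have := h1 Z Y X W
    linarith
  intro X Y Z W
  have := hB X Y Z W
  have h4 := a2 X Y Z W
  have h5 := a2 Y Z X W
  linarith

/-- The tensor `R - ν π₁` as a multilinear map. -/
theorem aux_T (R : V →ₗ[ℝ] V →ₗ[ℝ] V →ₗ[ℝ] V →ₗ[ℝ] ℝ) (ν : ℝ) :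
    ∃ T : V →ₗ[ℝ] V →ₗ[ℝ] V →ₗ[ℝ] V →ₗ[ℝ] ℝ,
      ∀ X Y Z W, T X Y Z W = R X Y Z W - ν * piOne X Y Z W := by
  refine ⟨LinearMap.mk₂ ℝ (fun X Y => LinearMap.mk₂ ℝ
    (fun Z W => R X Y Z W - ν * piOne X Y Z W) ?_ ?_ ?_ ?_) ?_ ?_ ?_ ?_, ?_⟩
  · intro a b c
    simp only [piOne, map_add, LinearMap.add_apply, inner_add_left, inner_add_right]; ring
  · intro a b c
    simp only [piOne, map_smul, LinearMap.smul_apply, inner_smul_left, inner_smul_right,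
      smul_eq_mul]; ring
  · intro a b c
    simp only [piOne, map_add, LinearMap.add_apply, inner_add_left, inner_add_right]; ring
  · intro a b c
    simp only [piOne, map_smul, LinearMap.smul_apply, inner_smul_left, inner_smul_right,
      smul_eq_mul]; ring
  · intro a b c
    ext z w
    simp only [LinearMap.mk₂_apply, piOne, map_add, LinearMap.add_apply, inner_add_left,
      inner_add_right]; ring
  · intro a b c
    ext z w
    simp only [LinearMap.mk₂_apply, piOne, map_smul, LinearMap.smul_apply, inner_smul_left,
      inner_smul_right, smul_eq_mul, conj_trivial]; ring
  · intro a b c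
    ext z w
    simp only [LinearMap.mk₂_apply, piOne, map_add, LinearMap.add_apply, inner_add_left,
      inner_add_right]; ring
  · intro a b c
    ext z w
    simp only [LinearMap.mk₂_apply, piOne, map_smul, LinearMap.smul_apply, inner_smul_left,
      inner_smul_right, smul_eq_mul, conj_trivial]; ring
  · intro X Y Z W
    simp only [LinearMap.mk₂_apply]

theorem aux_skew (J : V →ₗ[ℝ] V) (hJ2 : ∀ X : V, J (J X) = -X)
    (hJiso : ∀ X Y : V, ⟪J X, J Y⟫ = ⟪X, Y⟫) (X Y : V) : ⟪J X, Y⟫ = - ⟪X, J Y⟫ := by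
  have h := hJiso (J X) Y
  rw [hJ2, inner_neg_left] at h
  linarith

theorem aux_skew' (J : V →ₗ[ℝ] V) (hJ2 : ∀ X : V, J (J X) = -X)
    (hJiso : ∀ X Y : V, ⟪J X, J Y⟫ = ⟪X, Y⟫) (X Y : V) : ⟪X, J Y⟫ = - ⟪Y, J X⟫ := by
  rw [real_inner_comm, aux_skew J hJ2 hJiso]

/-- The sectional curvature form of `R - ν π₁` vanishes as soon as `ω(X,Y) = 0`. -/
theorem aux_vanish (J : V →ₗ[ℝ] V) (hJ2 : ∀ X : V, J (J X) = -X)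
    (hJiso : ∀ X Y : V, ⟪J X, J Y⟫ = ⟪X, Y⟫)
    (R : V →ₗ[ℝ] V →ₗ[ℝ] V →ₗ[ℝ] V →ₗ[ℝ] ℝ)
    (hR1 : ∀ X Y Z W : V, R X Y Z W = - R Y X Z W)
    (hR2 : ∀ X Y Z W : V, R X Y Z W = - R X Y W Z)
    (ν : ℝ)
    (hcasc : ∀ X Y : V, ⟪X, X⟫ = 1 → ⟪Y, Y⟫ = 1 → ⟪X, Y⟫ = 0 → ⟪X, J Y⟫ = 0 →
        R X Y X Y = ν) (X Y : V) (h : ⟪X, J Y⟫ = 0) :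
    R X Y X Y = ν * (⟪X, X⟫ * ⟪Y, Y⟫ - ⟪X, Y⟫ ^ 2) := by
  have hself : ∀ A : V, ⟪A, J A⟫ = 0 := by
    intro A
    have := aux_skew' J hJ2 hJiso A A
    linarith
  have hA : ∀ A Z W, R A A Z W = 0 := by
    intro A Z W
    have := hR1 A A Z W
    linarith
  have hB : ∀ A Z W, R Z W A A = 0 := by
    intro A Z W
    have := hR2 Z W A A
    linarith
  -- orthogonal case
  have horth : ∀ A B : V, ⟪A, B⟫ = 0 → ⟪A, J B⟫ = 0 →
      R A B A B = ν * (⟪A, A⟫ * ⟪B, B⟫) := by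
    intro A B h1 h2
    by_cases hA0 : A = 0
    · simp [hA0]
    by_cases hB0 : B = 0
    · simp [hB0]
    have ha : ‖A‖ ≠ 0 := norm_ne_zero_iff.mpr hA0
    have hb : ‖B‖ ≠ 0 := norm_ne_zero_iff.mpr hB0
    have := hcasc (‖A‖⁻¹ • A) (‖B‖⁻¹ • B)
      (by
        rw [real_inner_smul_left, real_inner_smul_right, real_inner_self_eq_norm_sq]; field_simp)
      (by
        rw [real_inner_smul_left, real_inner_smul_right, real_inner_self_eq_norm_sq]; field_simp)
      (by rw [real_inner_smul_left, real_inner_smul_right, h1]; ring)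
      (by rw [map_smul, real_inner_smul_left, real_inner_smul_right, h2]; ring)
    simp only [map_smul, LinearMap.smul_apply, smul_eq_mul] at this
    rw [real_inner_self_eq_norm_sq, real_inner_self_eq_norm_sq, ← this]
    field_simp
  by_cases hX : X = 0
  · simp [hX]
  have hN : ⟪X, X⟫ ≠ 0 := by simpa using hX
  have := horth X (Y - (⟪X, Y⟫ / ⟪X, X⟫) • X)
    (by rw [inner_sub_right, real_inner_smul_right]; field_simp; ring)
    (by rw [map_sub, map_smul, inner_sub_right, real_inner_smul_right, h, hself]; ring)
  simp only [map_sub, map_smul, LinearMap.sub_apply, LinearMap.smul_apply, smul_eq_mul,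
    inner_sub_left, inner_sub_right, real_inner_smul_left, real_inner_smul_right, hA, hB,
    real_inner_comm X Y] at this
  have h2 : R X Y X Y = ν * (⟪X, X⟫ *
      (⟪Y, Y⟫ - ⟪X, Y⟫ / ⟪X, X⟫ * ⟪X, Y⟫
        - ⟪X, Y⟫ / ⟪X, X⟫ * (⟪X, Y⟫ - ⟪X, Y⟫ / ⟪X, X⟫ * ⟪X, X⟫))) := by
    rw [real_inner_comm Y X] at *
    linarith
  rw [h2]
  field_simp
  ring

/-- Existence of the two-form. -/
theorem aux_exists (J : V →ₗ[ℝ] V) (hJ2 : ∀ X : V, J (J X) = -X)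
    (hJiso : ∀ X Y : V, ⟪J X, J Y⟫ = ⟪X, Y⟫)
    (T : V →ₗ[ℝ] V →ₗ[ℝ] V →ₗ[ℝ] V →ₗ[ℝ] ℝ)
    (h1 : ∀ X Y Z W : V, T X Y Z W = - T Y X Z W)
    (h2 : ∀ X Y Z W : V, T X Y Z W = - T X Y W Z)
    (h3 : ∀ X Y Z W : V, T X Y Z W = T Z W X Y)
    (h0 : ∀ X Y : V, ⟪X, J Y⟫ = 0 → T X Y X Y = 0) :
    ∃ s : V →ₗ[ℝ] V →ₗ[ℝ] ℝ, (∀ X Y, s X Y = - s Y X) ∧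
      ∀ X Y, T X Y X Y = 6 * (⟪X, J Y⟫ * s X Y) := by
  have hsk := aux_skew' J hJ2 hJiso
  have hXJX : ∀ X : V, ⟪X, J (J X)⟫ = - ⟪X, X⟫ := by
    intro X; rw [hJ2, inner_neg_right]
  let P : V → V → ℝ := fun X Y =>
    2 * ⟪X, X⟫ * T X Y X (J X) + ⟪X, J Y⟫ * T X (J X) X (J X)
  have hP : ∀ X Y, P X Y =
    2 * ⟪X, X⟫ * T X Y X (J X) + ⟪X, J Y⟫ * T X (J X) X (J X) := fun _ _ => rfl
  have e1 : ∀ X Y, ⟪X, X⟫ ^ 2 * T X Y X Y = - (⟪X, J Y⟫ * P X Y) := by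
    intro X Y
    have h := h0 X (⟪X, X⟫ • Y + ⟪X, J Y⟫ • J X)
      (by rw [map_add, map_smul, map_smul, inner_add_right, real_inner_smul_right,
            real_inner_smul_right, hXJX]; ring)
    simp only [map_add, map_smul, LinearMap.add_apply, LinearMap.smul_apply, smul_eq_mul] at h
    have := h3 X (J X) X Y
    rw [hP]
    rw [this] at h
    linarith
  have e2 : ∀ X Y, X ≠ 0 → ⟪Y, Y⟫ ^ 2 * P X Y + ⟪X, X⟫ ^ 2 * P Y X = 0 := by
    intro X Y hX
    have hN : ⟪X, X⟫ ≠ 0 := by simpa using hX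
    have e3 : ∀ Y, ⟪X, J Y⟫ ≠ 0 → ⟪Y, Y⟫ ^ 2 * P X Y + ⟪X, X⟫ ^ 2 * P Y X = 0 := by
      intro Y hY
      apply mul_left_cancel₀ hY
      have a := e1 X Y
      have b := e1 Y X
      have c : T Y X Y X = T X Y X Y := by rw [h1, h2]; ring
      rw [hsk Y X, c] at b
      linear_combination ⟪Y, Y⟫ ^ 2 * a - ⟪X, X⟫ ^ 2 * b
    by_cases hY : ⟪X, J Y⟫ = 0
    swap
    · exact e3 Y hY
    have key := Continuous.ext_on (dense_compl_singleton (0 : ℝ))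
      (f := fun t : ℝ => ⟪Y + t • J X, Y + t • J X⟫ ^ 2 * P X (Y + t • J X)
        + ⟪X, X⟫ ^ 2 * P (Y + t • J X) X) (g := fun _ => 0)
      (by
        simp only [hP, map_add, map_smul, LinearMap.add_apply, LinearMap.smul_apply, smul_eq_mul,
          inner_add_left, inner_add_right, real_inner_smul_left, real_inner_smul_right]
        fun_prop)
      continuous_const
      (by
        intro t ht
        apply e3
        rw [map_add, map_smul, inner_add_right, real_inner_smul_right, hXJX, hY]
        have : t ≠ 0 := ht
        simp [this, hX])
    have := congrFun key 0
    simpa using this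
  let l : V → V → ℝ := fun X Y => - P X Y / (6 * ⟪X, X⟫ ^ 2)
  have hl : ∀ X Y, l X Y = - P X Y / (6 * ⟪X, X⟫ ^ 2) := fun _ _ => rfl
  have hanti : ∀ X Y, l X Y = - l Y X := by
    intro X Y
    by_cases hX : X = 0
    · simp [hl, hP, hX]
    by_cases hY : Y = 0
    · simp [hl, hP, hY]
    have hN : ⟪X, X⟫ ≠ 0 := by simpa using hX
    have hM : ⟪Y, Y⟫ ≠ 0 := by simpa using hY
    have := e2 X Y hX
    rw [hl, hl]
    field_simp
    linarith
  have hadd : ∀ X Y Y', l X (Y + Y') = l X Y + l X Y' := by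
    intro X Y Y'
    simp only [hl, hP, map_add, LinearMap.add_apply, inner_add_right]
    ring
  have hsmul : ∀ (c : ℝ) X Y, l X (c • Y) = c * l X Y := by
    intro c X Y
    simp only [hl, hP, map_smul, LinearMap.smul_apply, real_inner_smul_right, smul_eq_mul]
    ring
  refine ⟨LinearMap.mk₂ ℝ l ?_ ?_ ?_ ?_, ?_, ?_⟩
  · intro X X' Y
    rw [hanti, hadd, hanti X, hanti X']; ring
  · intro c X Y
    rw [hanti, hsmul, hanti X, smul_eq_mul]; ring
  · exact hadd
  · exact hsmul
  · intro X Y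
    simpa using hanti X Y
  · intro X Y
    rw [LinearMap.mk₂_apply, hl]
    by_cases hX : X = 0
    · simp [hX]
    have hN : ⟪X, X⟫ ≠ 0 := by simpa using hX
    have := e1 X Y
    field_simp
    linarith

/-- Contraction against an orthonormal basis. -/
theorem aux_contract {ι : Type*} [Fintype ι] (b : OrthonormalBasis ι ℝ V) (A : V →ₗ[ℝ] ℝ)
    (X : V) : ∑ i, ⟪b i, X⟫ * A (b i) = A X := by
  conv_rhs => rw [← b.sum_repr' X]
  simp

end aux

/-- if an algebraic curvature tensor `R` on a `2n`-dimensional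
almost Hermitian inner product space (`n ≥ 2`) has constant antiholomorphic sectional
curvature `ν`, and `Q = (1/6)·ρ(R) + (1/(4(n+1)))·ρ*(R − L₃R)`, then
`R = ψ(Q) + ν·π₁ − ((2n−1)/3)·ν·π₂`. -/
theorem curvature_eq_psi_q
    {V : Type*} [NormedAddCommGroup V] [InnerProductSpace ℝ V]
    [FiniteDimensional ℝ V] (n : ℕ) (hn : 2 ≤ n)
    (hdim : Module.finrank ℝ V = 2 * n)
    (b : OrthonormalBasis (Fin (2 * n)) ℝ V)
    (J : V →ₗ[ℝ] V)
    (hJ2 : ∀ X : V, J (J X) = -X)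
    (hJiso : ∀ X Y : V, ⟪J X, J Y⟫ = ⟪X, Y⟫)
    (R : V →ₗ[ℝ] V →ₗ[ℝ] V →ₗ[ℝ] V →ₗ[ℝ] ℝ)
    (hR1 : ∀ X Y Z W : V, R X Y Z W = - R Y X Z W)
    (hR2 : ∀ X Y Z W : V, R X Y Z W = - R X Y W Z)
    (hR3 : ∀ X Y Z W : V, R X Y Z W = R Z W X Y)
    (hBianchi : ∀ X Y Z W : V, R X Y Z W + R Y Z X W + R Z X Y W = 0)
    (ν : ℝ)
    (hcasc : ∀ X Y : V, ⟪X, X⟫ = 1 → ⟪Y, Y⟫ = 1 → ⟪X, Y⟫ = 0 → ⟪X, J Y⟫ = 0 →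
        R X Y X Y = ν) :
    ∀ X Y Z W : V,
      R X Y Z W =
        psiT J (qTensor n b J (fun a b' c d => R a b' c d)) X Y Z W
          + ν * piOne X Y Z W
          - ((2 * (n : ℝ) - 1) / 3) * ν * piTwo J X Y Z W := by
  have hsk := aux_skew' J hJ2 hJiso
  obtain ⟨T, hT⟩ := aux_T R ν
  have hp1 : ∀ X Y Z W : V, T X Y Z W = - T Y X Z W := by
    intro X Y Z W
    rw [hT, hT, hR1 X Y]; simp only [piOne]; ring
  have hp2 : ∀ X Y Z W : V, T X Y Z W = - T X Y W Z := by
    intro X Y Z W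
    rw [hT, hT, hR2 X Y]; simp only [piOne]; ring
  have hp3 : ∀ X Y Z W : V, T X Y Z W = T Z W X Y := by
    intro X Y Z W
    rw [hT, hT, hR3 X Y]
    simp only [piOne, real_inner_comm X, real_inner_comm Y]
    rw [real_inner_comm Z X, real_inner_comm W X, real_inner_comm Z Y, real_inner_comm W Y]; ring
  have hpB : ∀ X Y Z W : V, T X Y Z W + T Y Z X W + T Z X Y W = 0 := by
    intro X Y Z W
    rw [hT, hT, hT]
    simp only [piOne]
    rw [real_inner_comm X Z, real_inner_comm X Y, real_inner_comm Y Z]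
    linear_combination hBianchi X Y Z W
  obtain ⟨s, hs, hTs⟩ := aux_exists J hJ2 hJiso T hp1 hp2 hp3 (by
    intro X Y h
    rw [hT, aux_vanish J hJ2 hJiso R hR1 hR2 ν hcasc X Y h, piOne, real_inner_comm X Y]
    ring)
  have hTf : ∀ X Y Z W, T X Y Z W = 2 * ⟪X, J Y⟫ * s Z W + 2 * ⟪Z, J W⟫ * s X Y
    + ⟪X, J Z⟫ * s Y W + ⟪Y, J W⟫ * s X Z
    - ⟪X, J W⟫ * s Y Z - ⟪Y, J Z⟫ * s X W := by
    intro X Y Z W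
    have := aux_polar (fun X Y Z W => T X Y Z W - (2 * ⟪X, J Y⟫ * s Z W + 2 * ⟪Z, J W⟫ * s X Y
      + ⟪X, J Z⟫ * s Y W + ⟪Y, J W⟫ * s X Z
      - ⟪X, J W⟫ * s Y Z - ⟪Y, J Z⟫ * s X W))
      (by
        intro X X' Y Z W
        simp only [map_add, LinearMap.add_apply, inner_add_left]; ring)
      (by
        intro X Y Z W
        rw [hp1 X Y, hsk X Y, hs X Y]; ring)
      (by
        intro X Y Z W
        rw [hp3 X Y, hsk Z X, hsk W Y, hsk Z Y, hsk W X, hs Z X, hs W Y, hs Z Y, hs W X]; ring)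
      (by
        intro X Y Z W
        rw [hsk Z X, hs Z X, hsk Y X, hs Y X, hsk Z Y, hs Z Y]
        linear_combination hpB X Y Z W)
      (by
        intro X Y
        have a := hsk X X
        have b := hs X X
        have c := hs Y X
        rw [hTs, hsk Y X, c]
        have a' : ⟪X, J X⟫ = 0 := by linarith
        have b' : s X X = 0 := by linarith
        rw [a', b']; ring)
      X Y Z W
    linarith
  have hRf : ∀ X Y Z W, R X Y Z W = 2 * ⟪X, J Y⟫ * s Z W + 2 * ⟪Z, J W⟫ * s X Y
    + ⟪X, J Z⟫ * s Y W + ⟪Y, J W⟫ * s X Z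
    - ⟪X, J W⟫ * s Y Z - ⟪Y, J Z⟫ * s X W + ν * (⟪X, Z⟫ * ⟪Y, W⟫ - ⟪Y, Z⟫ * ⟪X, W⟫) := by
    intro X Y Z W
    have := hTf X Y Z W
    rw [hT, piOne] at this
    linarith
  have hss : ∀ X, s X X = 0 := fun X => by have := hs X X; linarith
  have hww : ∀ X : V, ⟪X, J X⟫ = 0 := fun X => by have := hsk X X; linarith
  have hric : ∀ X Y, ricci b (fun a b' c d => R a b' c d) X Y =
      3 * s (J X) Y + 3 * s (J Y) X + ν * (2 * n - 1) * ⟪X, Y⟫ := by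
    intro X Y
    have t1 := aux_contract b (s.flip Y) (J X)
    have t2 := aux_contract b (s.flip X) (J Y)
    have t3 := aux_contract b (innerₗ V Y) X
    have t4 : ∑ i, ⟪b i, b i⟫ = 2 * (n : ℝ) := by simp
    simp only [LinearMap.flip_apply, innerₗ_apply_apply] at t1 t2 t3
    rw [ricci]
    have : ∀ i, R (b i) X (b i) Y = 3 * (⟪b i, J X⟫ * s (b i) Y) + 3 * (⟪b i, J Y⟫ * s (b i) X)
        + ν * (⟪b i, b i⟫ * ⟪X, Y⟫ - ⟪b i, X⟫ * ⟪Y, b i⟫) := by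
      intro i
      rw [hRf, hss, hww, hs X (b i), hsk X (b i), real_inner_comm (b i) X,
        real_inner_comm (b i) Y]; ring
    simp only [this, Finset.sum_add_distrib, ← Finset.mul_sum, Finset.sum_sub_distrib,
      ← Finset.sum_mul]
    rw [t1, t2, t3, t4, real_inner_comm X Y]; ring
  have hstar0 : ∀ X Y, ∑ i, R (b i) X (J (b i)) (J Y) =
      -(2 * n + 2) * s X (J Y) - (∑ i, s (b i) (J (b i))) * ⟪X, Y⟫ + ν * ⟪X, Y⟫ := by
    intro X Y
    have t1 := aux_contract b ((s.flip (J Y)).comp J) (J X)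
    have t2 := aux_contract b (s.flip X) (J Y)
    have t3 := aux_contract b ((s X).comp J) Y
    have t4 := aux_contract b (s.flip (J Y)) X
    have t5 := aux_contract b (innerₗ V Y) X
    have t6 : ∑ i, ⟪b i, b i⟫ = 2 * (n : ℝ) := by simp
    simp only [LinearMap.flip_apply, LinearMap.comp_apply, innerₗ_apply_apply, hJ2, map_neg,
      LinearMap.neg_apply] at t1 t2 t3 t4 t5
    have : ∀ i, R (b i) X (J (b i)) (J Y) =
        2 * (⟪b i, J X⟫ * s (J (b i)) (J Y)) + 2 * (⟪b i, J Y⟫ * s (b i) X)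
        - ⟪b i, b i⟫ * s X (J Y) - ⟪X, Y⟫ * s (b i) (J (b i))
        + ⟪b i, Y⟫ * s X (J (b i)) + ⟪b i, X⟫ * s (b i) (J Y)
        + ν * (⟪b i, J X⟫ * ⟪b i, J Y⟫) := by
      intro i
      rw [hRf, hww, hJiso, hJ2, hJ2, inner_neg_right, inner_neg_right, inner_neg_right,
        inner_neg_right, hsk X (b i), real_inner_comm (b i) X]; ring
    have t7 := aux_contract b (innerₗ V (J Y)) (J X)
    simp only [innerₗ_apply_apply] at t7
    have t8 : ∑ i, ⟪b i, J X⟫ * ⟪b i, J Y⟫ = ⟪X, Y⟫ := by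
      simp only [real_inner_comm (J Y)] at t7 ⊢
      rw [← hJiso X Y, ← real_inner_comm (J X), ← t7]
    simp only [this, Finset.sum_add_distrib, ← Finset.mul_sum, Finset.sum_sub_distrib,
      ← Finset.sum_mul]
    rw [t1, t2, t3, t4, t6, t8, hs (J Y) X]; ring
  have hstar : ∀ X Y, rhoStar b J
      (fun a b' c d => R a b' c d - R (J a) (J b') (J c) (J d)) X Y =
      -(2 * n + 2) * (s X (J Y) - s Y (J X)) := by
    intro X Y
    have : ∀ i, R (J (b i)) (J X) (J (J (b i))) (J (J Y)) = R (b i) Y (J (b i)) (J X) := by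
      intro i
      have hneg : R (-b i) = (-1 : ℝ) • R (b i) := by rw [← map_smul, neg_one_smul]
      rw [hJ2, hJ2, hR3, hneg]; simp
    simp only [rhoStar, this, Finset.sum_sub_distrib]
    rw [hstar0, hstar0, real_inner_comm X Y]; ring
  have hQ : ∀ X Y, qTensor n b J (fun a b' c d => R a b' c d) X (J Y) =
      s X Y + ν * (2 * n - 1) / 6 * ⟪X, J Y⟫ := by
    intro X Y
    have hn0 : (n : ℝ) + 1 ≠ 0 := by positivity
    rw [qTensor, hric, hstar, hJ2, map_neg, map_neg, LinearMap.neg_apply, hs Y X, hs (J Y) (J X)]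
    field_simp
    ring
  intro X Y Z W
  rw [psiT, hQ, hQ, hQ, hQ, hQ, hQ, hRf, piOne, piTwo]
  simp only [aux_skew J hJ2 hJiso]
  ring
end

section
/- Let V be a real inner product space of dimension 2n with n ≥ 2, with inner product g and a linear isometry J : V → V satisfying J∘J = −id, and let R be an algebraic curvature tensor on V with constant antiholomorphic sectional curvature ν. Then the following are equivalent: (i) there exists λ ∈ ℝ such that ρ(R)(X,Y) = λ·g(X,Y) for all X,Y ∈ V; (ii) there exists μ ∈ ℝ such that R(X,JX,X,JX) = μ for every unit vector X ∈ V (i.e. R has constant holomorphic sectional curvature). -/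
open scoped RealInnerProductSpace BigOperators

theorem ricci_unit
    {V : Type*} [NormedAddCommGroup V] [InnerProductSpace ℝ V]
    (n : ℕ)
    (b : OrthonormalBasis (Fin (2 * n)) ℝ V)
    (J : V →ₗ[ℝ] V)
    (hJ2 : ∀ X : V, J (J X) = -X)
    (hJiso : ∀ X Y : V, ⟪J X, J Y⟫ = ⟪X, Y⟫)
    (R : V →ₗ[ℝ] V →ₗ[ℝ] V →ₗ[ℝ] V →ₗ[ℝ] ℝ)
    (hR1 : ∀ X Y Z W : V, R X Y Z W = - R Y X Z W)
    (hR2 : ∀ X Y Z W : V, R X Y Z W = - R X Y W Z)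
    (hR3 : ∀ X Y Z W : V, R X Y Z W = R Z W X Y)
    (ν : ℝ)
    (hcasc : ∀ X Y : V, ⟪X, X⟫ = 1 → ⟪Y, Y⟫ = 1 → ⟪X, Y⟫ = 0 → ⟪X, J Y⟫ = 0 →
        R X Y X Y = ν) (X : V) (hX : ⟪X, X⟫ = 1) :
    ricci b (fun a b' c d => R a b' c d) X X = R X (J X) X (J X) + (2 * n - 2) * ν := by
  have hH : R X (J X) X (J X) = R (J X) X (J X) X := by
    rw [hR1, hR2, neg_neg]
  have hJX : ⟪J X, J X⟫ = 1 := by rw [hJiso, hX]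
  have hXJ : ⟪X, J X⟫ = 0 := by
    have h := hJiso X (J X)
    rw [hJ2, inner_neg_right, real_inner_comm] at h
    linarith
  have hJX' : ⟪J X, X⟫ = 0 := by rw [real_inner_comm, hXJ]
  have hz1 : ∀ Z W, R X X Z W = 0 := fun Z W => by have := hR1 X X Z W; linarith
  have hz2 : ∀ Z W, R Z W X X = 0 := fun Z W => by have := hR2 Z W X X; linarith
  have key : ∀ Z : V, ⟪X, Z⟫ = 0 → ⟪J X, Z⟫ = 0 → R Z X Z X = ν * ⟪Z, Z⟫ := by
    intro Z h1 h2
    by_cases hZ : Z = 0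
    · simp [hZ]
    have hn0 : ‖Z‖ ≠ 0 := norm_ne_zero_iff.mpr hZ
    have hZJ : ⟪Z, J X⟫ = 0 := by rw [real_inner_comm, h2]
    have hZX : ⟪Z, X⟫ = 0 := by rw [real_inner_comm, h1]
    have h := hcasc (‖Z‖⁻¹ • Z) X
      (by rw [inner_smul_left, inner_smul_right, real_inner_self_eq_norm_sq]
          simp; field_simp) hX
      (by rw [inner_smul_left, hZX, mul_zero]) (by rw [inner_smul_left, hZJ, mul_zero])
    simp only [map_smul, LinearMap.smul_apply, smul_eq_mul] at h
    rw [real_inner_self_eq_norm_sq, ← h]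
    field_simp
  have hterm : ∀ i, R (b i) X (b i) X =
      2 * (⟪b i, J X⟫ * R (J X) X (b i) X) - ⟪J X, b i⟫ * ⟪b i, J X⟫ * R (J X) X (J X) X
        + ν * (1 - ⟪X, b i⟫ * ⟪b i, X⟫ - ⟪J X, b i⟫ * ⟪b i, J X⟫) := by
    intro i
    have hb : ⟪b i, b i⟫ = 1 := by
      rw [real_inner_self_eq_norm_sq, b.orthonormal.1 i]; norm_num
    have h := key (b i - ⟪X, b i⟫ • X - ⟪J X, b i⟫ • J X)
      (by simp only [inner_sub_right, inner_smul_right, hX, hXJ]; ring)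
      (by simp only [inner_sub_right, inner_smul_right, hJX, hJX']; ring)
    have hs := hR3 (b i) X (J X) X
    have hexp : ∀ (a c : ℝ) (Z W : V), R (Z - a • X - c • J X) X W X
        = R Z X W X - a * R X X W X - c * R (J X) X W X := by
      intro a c Z W
      have e : Z - a • X - c • J X = Z + (-a) • X + (-c) • J X := by
        rw [neg_smul, neg_smul]; abel
      rw [e, R.map_add, R.map_add, R.map_smul, R.map_smul]
      simp only [LinearMap.add_apply, LinearMap.smul_apply, smul_eq_mul]
      ring
    rw [hexp] at h
    simp only [inner_sub_right, inner_sub_left, inner_smul_right, inner_smul_left, hX, hXJ, hJX,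
      hJX', hb, map_sub, map_smul, LinearMap.sub_apply, LinearMap.smul_apply, smul_eq_mul,
      hz1, hz2, hs, real_inner_comm X (b i), real_inner_comm (J X) (b i), conj_trivial] at h ⊢
    linarith
  have hp : ∀ Y : V, ∑ i, ⟪Y, b i⟫ * ⟪b i, Y⟫ = ⟪Y, Y⟫ := fun Y => b.sum_inner_mul_inner Y Y
  have hq : ∑ i, ⟪b i, J X⟫ * R (J X) X (b i) X = R (J X) X (J X) X := by
    have h : R (J X) X (∑ i, ⟪b i, J X⟫ • b i) X = ∑ i, ⟪b i, J X⟫ * R (J X) X (b i) X := by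
      simp [map_sum, LinearMap.sum_apply]
    rw [← h, b.sum_repr']
  unfold ricci
  simp only [hterm, Finset.sum_add_distrib, Finset.sum_sub_distrib, ← Finset.mul_sum,
    ← Finset.sum_mul, hp, hq, hX, hJX, hH]
  simp
  ring

/-- for an algebraic curvature tensor `R` on a `2n`-dimensional
almost Hermitian inner product space (`n ≥ 2`) with constant antiholomorphic
sectional curvature `ν`, the Ricci tensor is a multiple of the metric (Einstein
condition) iff `R` has constant holomorphic sectional curvature. -/
theorem einstein_iff_constant_holomorphic
    {V : Type*} [NormedAddCommGroup V] [InnerProductSpace ℝ V]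
    [FiniteDimensional ℝ V] (n : ℕ) (hn : 2 ≤ n)
    (hdim : Module.finrank ℝ V = 2 * n)
    (b : OrthonormalBasis (Fin (2 * n)) ℝ V)
    (J : V →ₗ[ℝ] V)
    (hJ2 : ∀ X : V, J (J X) = -X)
    (hJiso : ∀ X Y : V, ⟪J X, J Y⟫ = ⟪X, Y⟫)
    (R : V →ₗ[ℝ] V →ₗ[ℝ] V →ₗ[ℝ] V →ₗ[ℝ] ℝ)
    (hR1 : ∀ X Y Z W : V, R X Y Z W = - R Y X Z W)
    (hR2 : ∀ X Y Z W : V, R X Y Z W = - R X Y W Z)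
    (hR3 : ∀ X Y Z W : V, R X Y Z W = R Z W X Y)
    (hBianchi : ∀ X Y Z W : V, R X Y Z W + R Y Z X W + R Z X Y W = 0)
    (ν : ℝ)
    (hcasc : ∀ X Y : V, ⟪X, X⟫ = 1 → ⟪Y, Y⟫ = 1 → ⟪X, Y⟫ = 0 → ⟪X, J Y⟫ = 0 →
        R X Y X Y = ν) :
    (∃ lam : ℝ, ∀ X Y : V, ricci b (fun a b' c d => R a b' c d) X Y = lam * ⟪X, Y⟫) ↔
      (∃ μ : ℝ, ∀ X : V, ⟪X, X⟫ = 1 → R X (J X) X (J X) = μ) := by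
  have hu := ricci_unit n b J hJ2 hJiso R hR1 hR2 hR3 ν hcasc
  constructor
  · rintro ⟨lam, h⟩
    refine ⟨lam - (2 * n - 2) * ν, fun X hX => ?_⟩
    have h1 := hu X hX
    rw [h X X, hX] at h1
    linarith
  · rintro ⟨μ, h⟩
    have hd : ∀ X : V, ricci b (fun a b' c d => R a b' c d) X X
        = (μ + (2 * n - 2) * ν) * ⟪X, X⟫ := by
      intro X
      by_cases hX : X = 0
      · simp [hX, ricci]
      have hn0 : ‖X‖ ≠ 0 := norm_ne_zero_iff.mpr hX
      have hunit : ⟪‖X‖⁻¹ • X, ‖X‖⁻¹ • X⟫ = 1 := by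
        rw [inner_smul_left, inner_smul_right, real_inner_self_eq_norm_sq]
        simp; field_simp
      have h1 := hu _ hunit
      rw [h _ hunit] at h1
      simp only [ricci, map_smul, LinearMap.smul_apply, smul_eq_mul, ← Finset.mul_sum] at h1
      rw [real_inner_self_eq_norm_sq, ← h1]
      simp only [ricci]
      field_simp
    refine ⟨μ + (2 * n - 2) * ν, fun X Y => ?_⟩
    have h1 := hd (X + Y)
    have h2 := hd X
    have h3 := hd Y
    have hs : ricci b (fun a b' c d => R a b' c d) Y X
        = ricci b (fun a b' c d => R a b' c d) X Y := by
      simp only [ricci]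
      exact Finset.sum_congr rfl fun i _ => hR3 _ _ _ _
    have he : ricci b (fun a b' c d => R a b' c d) (X + Y) (X + Y)
        = ricci b (fun a b' c d => R a b' c d) X X + ricci b (fun a b' c d => R a b' c d) X Y
        + (ricci b (fun a b' c d => R a b' c d) Y X
          + ricci b (fun a b' c d => R a b' c d) Y Y) := by
      simp only [ricci, ← Finset.sum_add_distrib]
      refine Finset.sum_congr rfl fun i _ => ?_
      simp only [map_add, LinearMap.add_apply]
      ring
    rw [he, hs, h2, h3, inner_add_left, inner_add_right, inner_add_right,
      real_inner_comm X Y] at h1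
    linarith
end

section
/- Let V be a real inner product space of dimension 2n with n ≥ 1, with inner product g and a linear isometry J : V → V satisfying J∘J = −id. Let F : V×V×V → ℝ be a trilinear map satisfying (i) F(V,Y,X) = −F(V,X,Y), (ii) F(V,JX,JY) = −F(V,X,Y), and (iii) F(V,X,Y) + F(X,Y,V) + F(Y,V,X) = 0 for all V,X,Y. Then F(JX,JY,Z) = −F(X,Y,Z) for all X,Y,Z ∈ V. (This is the pointwise statement that an almost Kähler structure satisfies the quasi-Kähler identity (∇_X J)Y + (∇_{JX}J)JY = 0, where F(V,X,Y) = (∇_V ω)(X,Y) = g((∇_V J)X, Y).) -/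
open scoped RealInnerProductSpace BigOperators

/-- a trilinear map `F` on a `2n`-dimensional (`n ≥ 1`) almost Hermitian
inner product space, which is skew in its last two arguments, anti-`J`-invariant in
its last two arguments, and has vanishing cyclic sum (the almost Kähler condition),
satisfies the quasi-Kähler identity `F(JX, JY, Z) = −F(X, Y, Z)`. -/
theorem almostKaehler_quasiKaehler_identity
    {V : Type*} [NormedAddCommGroup V] [InnerProductSpace ℝ V]
    [FiniteDimensional ℝ V] (n : ℕ) (hn : 1 ≤ n)
    (hdim : Module.finrank ℝ V = 2 * n)
    (J : V →ₗ[ℝ] V)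
    (hJ2 : ∀ X : V, J (J X) = -X)
    (hJiso : ∀ X Y : V, ⟪J X, J Y⟫ = ⟪X, Y⟫)
    (F : V →ₗ[ℝ] V →ₗ[ℝ] V →ₗ[ℝ] ℝ)
    (hF1 : ∀ U X Y : V, F U Y X = - F U X Y)
    (hF2 : ∀ U X Y : V, F U (J X) (J Y) = - F U X Y)
    (hF3 : ∀ U X Y : V, F U X Y + F X Y U + F Y U X = 0) :
    ∀ X Y Z : V, F (J X) (J Y) Z = - F X Y Z := by
  have hs : ∀ U A B : V, F U (J A) B = F U A (J B) := by
    intro U A B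
    have h := hF2 U A (J B)
    rw [hJ2, map_neg] at h
    linarith
  intro X Y Z
  have h0 := hF3 X Y Z
  have h1 := hF3 (J X) (J Y) Z
  have h2 := hF3 (J X) Y (J Z)
  have h3 := hF3 X (J Y) (J Z)
  rw [hF2] at h1 h2 h3
  linarith [hs (J X) Y Z, hs (J Y) Z X, hs (J Z) X Y]
end

section
/- Let V be a real inner product space of dimension 2n with n ≥ 1, with inner product g and a linear isometry J : V → V satisfying J∘J = −id. Let F : V×V×V → ℝ be a trilinear map satisfying (i) F(V,Y,X) = −F(V,X,Y), (ii) F(V,JX,JY) = −F(V,X,Y), and (iii) F(V,X,Y) + F(X,Y,V) + F(Y,V,X) = 0 for all V,X,Y. Then for every orthonormal basis (e_i) of V and every Z ∈ V, Σ_i F(e_i, e_i, Z) = 0. (This is the pointwise statement that on an almost Kähler manifold Σ_i (∇_{e_i} J)e_i = 0, where F(V,X,Y) = (∇_V ω)(X,Y) = g((∇_V J)X, Y).) -/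
open scoped RealInnerProductSpace BigOperators

/-- The trace of a bilinear form is unchanged when the orthonormal basis is rotated by `J`. -/
theorem trace_J_invariant {V : Type*} [NormedAddCommGroup V] [InnerProductSpace ℝ V]
    {ι : Type*} [Fintype ι] (J : V →ₗ[ℝ] V)
    (hJ2 : ∀ X : V, J (J X) = -X)
    (hJiso : ∀ X Y : V, ⟪J X, J Y⟫ = ⟪X, Y⟫)
    (b : OrthonormalBasis ι ℝ V) (B : V →ₗ[ℝ] V →ₗ[ℝ] ℝ) :
    ∑ i, B (J (b i)) (J (b i)) = ∑ i, B (b i) (b i) := by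
  have h1 : ∀ i, B (J (b i)) (J (b i)) = ∑ j, ⟪b j, J (b i)⟫ * B (b j) (J (b i)) := by
    intro i
    have h := congrArg (fun v => B v (J (b i))) (b.sum_repr' (J (b i)))
    simpa using h.symm
  have h2 : ∀ j, ∑ i, ⟪b j, J (b i)⟫ * B (b j) (J (b i)) = B (b j) (b j) := by
    intro j
    have h := congrArg (fun v => B (b j) (J v)) (b.sum_repr' (J (b j)))
    simp only [map_sum, map_smul, smul_eq_mul, hJ2, map_neg] at h
    have h3 : ∀ i, ⟪b j, J (b i)⟫ = -⟪b i, J (b j)⟫ := by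
      intro i
      rw [← hJiso, hJ2, inner_neg_right, real_inner_comm]
    simp only [h3, neg_mul, Finset.sum_neg_distrib]
    linarith
  simp_rw [h1]
  rw [Finset.sum_comm]
  simp_rw [h2]

/-- a trilinear map `F` on a `2n`-dimensional (`n ≥ 1`) almost Hermitian
inner product space, which is skew in its last two arguments, anti-`J`-invariant in
its last two arguments, and has vanishing cyclic sum (the almost Kähler condition),
satisfies `Σ_i F(e_i, e_i, Z) = 0` for every orthonormal basis `(e_i)` and every `Z`.
(Pointwise form of `Σ_i (∇_{e_i} J) e_i = 0` on an almost Kähler manifold.) -/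
theorem almostKaehler_trace_vanishes
    {V : Type*} [NormedAddCommGroup V] [InnerProductSpace ℝ V]
    [FiniteDimensional ℝ V] (n : ℕ) (hn : 1 ≤ n)
    (hdim : Module.finrank ℝ V = 2 * n)
    (J : V →ₗ[ℝ] V)
    (hJ2 : ∀ X : V, J (J X) = -X)
    (hJiso : ∀ X Y : V, ⟪J X, J Y⟫ = ⟪X, Y⟫)
    (F : V →ₗ[ℝ] V →ₗ[ℝ] V →ₗ[ℝ] ℝ)
    (hF1 : ∀ U X Y : V, F U Y X = - F U X Y)
    (hF2 : ∀ U X Y : V, F U (J X) (J Y) = - F U X Y)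
    (hF3 : ∀ U X Y : V, F U X Y + F X Y U + F Y U X = 0) :
    ∀ (b : OrthonormalBasis (Fin (2 * n)) ℝ V) (Z : V),
      ∑ i, F (b i) (b i) Z = 0 := by
  intro b Z
  have hA := trace_J_invariant J hJ2 hJiso b ((F (J Z)).compl₂ J)
  have hB := trace_J_invariant J hJ2 hJiso b ((F.flip.compr₂ LinearMap.id).flip.compl₂ J |>.compr₂
    (LinearMap.applyₗ (J Z)))
  simp only [LinearMap.compl₂_apply, LinearMap.compr₂_apply, LinearMap.flip_apply,
    LinearMap.id_apply, LinearMap.applyₗ_apply_apply, hJ2, hF2, map_neg,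
    Finset.sum_neg_distrib] at hB
  simp only [LinearMap.compl₂_apply, hF2, Finset.sum_neg_distrib] at hA
  have hC : ∑ i, (F (b i) (J (b i)) (J Z) + F (J (b i)) (J Z) (b i)
      + F (J Z) (b i) (J (b i))) = 0 :=
    Finset.sum_eq_zero fun i _ => hF3 _ _ _
  have hD : ∀ i, F (J (b i)) (J Z) (b i) = - F (J (b i)) (b i) (J Z) := fun i => hF1 _ _ _
  simp only [Finset.sum_add_distrib, hD, hF2, Finset.sum_neg_distrib] at hC
  linarith
end

section
/- Let V be a real inner product space of dimension 2n with n ≥ 1, with inner product g and a linear isometry J : V → V satisfying J∘J = −id. Let F : V×V×V → ℝ be a trilinear map satisfying (i) F(V,Y,X) = −F(V,X,Y), (ii) F(V,JX,JY) = −F(V,X,Y), and (iii) F(V,X,Y) + F(X,Y,V) + F(Y,V,X) = 0 for all V,X,Y, and let Q : V×V → ℝ be a bilinear map with Q(JX,JY) = Q(Y,X) for all X,Y. For V,X ∈ V let A_V X ∈ V denote the unique vector with g(A_V X, Z) = F(V,X,Z) for all Z. Then for every orthonormal basis (e_i) of V and every vector U ∈ V: 2·Σ_i Q(Je_i, A_{e_i}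 U) = Σ_i Q(Je_i, A_U e_i). -/
open scoped RealInnerProductSpace BigOperators

/-- let `F` be a trilinear map on a `2n`-dimensional (`n ≥ 1`) almost
Hermitian inner product space which is skew in its last two arguments,
anti-`J`-invariant in its last two arguments, and has vanishing cyclic sum (the almost
Kähler condition), and let `Q` be a bilinear map with `Q(JX,JY) = Q(Y,X)`.
If `A_V X` denotes the vector with `g(A_V X, Z) = F(V,X,Z)` for all `Z`
(so `A_V` corresponds to `∇_V J`), then for every orthonormal basis `(e_i)` and every
`U`: `2·Σ_i Q(Je_i, A_{e_i} U) = Σ_i Q(Je_i, A_U e_i)`. -/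
theorem almostKaehler_Q_trace_identity
    {V : Type*} [NormedAddCommGroup V] [InnerProductSpace ℝ V]
    [FiniteDimensional ℝ V] (n : ℕ) (hn : 1 ≤ n)
    (hdim : Module.finrank ℝ V = 2 * n)
    (J : V →ₗ[ℝ] V)
    (hJ2 : ∀ X : V, J (J X) = -X)
    (hJiso : ∀ X Y : V, ⟪J X, J Y⟫ = ⟪X, Y⟫)
    (F : V →ₗ[ℝ] V →ₗ[ℝ] V →ₗ[ℝ] ℝ)
    (hF1 : ∀ U X Y : V, F U Y X = - F U X Y)
    (hF2 : ∀ U X Y : V, F U (J X) (J Y) = - F U X Y)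
    (hF3 : ∀ U X Y : V, F U X Y + F X Y U + F Y U X = 0)
    (Q : V →ₗ[ℝ] V →ₗ[ℝ] ℝ)
    (hQ : ∀ X Y : V, Q (J X) (J Y) = Q Y X)
    (A : V → V → V)
    (hA : ∀ U X Z : V, ⟪A U X, Z⟫ = F U X Z) :
    ∀ (b : OrthonormalBasis (Fin (2 * n)) ℝ V) (U : V),
      2 * ∑ i, Q (J (b i)) (A (b i) U) = ∑ i, Q (J (b i)) (A U (b i)) := by
  intro b U
  have hP : ∀ X Y : V, Q (J X) Y = - Q (J Y) X := by
    intro X Y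
    have h := hQ X (J Y)
    rw [hJ2, map_neg] at h
    linarith
  have hexp : ∀ X W Z : V, Q (J Z) (A X W) = ∑ j, Q (J Z) (b j) * F X W (b j) := by
    intro X W Z
    conv_lhs => rw [← b.sum_repr' (A X W)]
    rw [map_sum]
    refine Finset.sum_congr rfl fun j _ => ?_
    rw [map_smul, smul_eq_mul, real_inner_comm, hA, mul_comm]
  simp only [hexp]
  have hswap : ∑ i, ∑ j, Q (J (b i)) (b j) * F (b i) U (b j)
      = ∑ i, ∑ j, -(Q (J (b i)) (b j) * F (b j) U (b i)) := by
    rw [Finset.sum_comm]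
    refine Finset.sum_congr rfl fun i _ => Finset.sum_congr rfl fun j _ => ?_
    rw [hP (b j) (b i)]
    ring
  rw [two_mul]
  nth_rewrite 2 [hswap]
  rw [← Finset.sum_add_distrib]
  refine Finset.sum_congr rfl fun i _ => ?_
  rw [← Finset.sum_add_distrib]
  refine Finset.sum_congr rfl fun j _ => ?_
  have h3 := hF3 U (b i) (b j)
  have h1 := hF1 (b i) U (b j)
  have h : F U (b i) (b j) = F (b i) U (b j) - F (b j) U (b i) := by linarith
  rw [h]
  ring
end

section
/- Let V be a real inner product space of dimension 2n with n ≥ 4, with inner product g and a linear isometry J : V → V satisfying J∘J = −id. Let S : V×V → ℝ be a bilinear map with S(JX,JY) = −S(X,Y) for all X,Y, and let F : V×V×V → ℝ be a nonzero trilinear map satisfying F(V,Y,X) = −F(V,X,Y) and F(V,JX,JY) = −F(V,X,Y) for all V,X,Y. Suppose that for all V,X,Y,Z,W ∈ V: S(X,Z)F(V,JY,W) − S(Y,Z)F(V,JX,W) − S(JX,Z)F(V,Y,W) + S(JY,Z)F(V,X,W) = 0. Then S = 0. -/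
open scoped RealInnerProductSpace BigOperators

/-- key step, equation (3.4): on a `2n`-dimensional (`n ≥ 4`) almost
Hermitian inner product space, let `S` be a bilinear map with `S(JX,JY) = −S(X,Y)`
and let `F` be a nonzero trilinear map, skew and anti-`J`-invariant in its last two
arguments. If for all `V, X, Y, Z, W`:
`S(X,Z)F(V,JY,W) − S(Y,Z)F(V,JX,W) − S(JX,Z)F(V,Y,W) + S(JY,Z)F(V,X,W) = 0`,
then `S = 0`. -/
theorem skew_hermitian_part_vanishes
    {V : Type*} [NormedAddCommGroup V] [InnerProductSpace ℝ V]
    [FiniteDimensional ℝ V] (n : ℕ) (hn : 4 ≤ n)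
    (hdim : Module.finrank ℝ V = 2 * n)
    (J : V →ₗ[ℝ] V)
    (hJ2 : ∀ X : V, J (J X) = -X)
    (hJiso : ∀ X Y : V, ⟪J X, J Y⟫ = ⟪X, Y⟫)
    (S : V →ₗ[ℝ] V →ₗ[ℝ] ℝ)
    (hS : ∀ X Y : V, S (J X) (J Y) = - S X Y)
    (F : V →ₗ[ℝ] V →ₗ[ℝ] V →ₗ[ℝ] ℝ)
    (hFne : F ≠ 0)
    (hF1 : ∀ U X Y : V, F U Y X = - F U X Y)
    (hF2 : ∀ U X Y : V, F U (J X) (J Y) = - F U X Y)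
    (hMain : ∀ U X Y Z W : V,
      S X Z * F U (J Y) W - S Y Z * F U (J X) W -
        S (J X) Z * F U Y W + S (J Y) Z * F U X W = 0) :
    S = 0 := by
  by_contra hne
  apply hFne
  have hex : ∃ X Z, S X Z ≠ 0 := by
    by_contra h
    push Not at h
    exact hne (by ext X Z; simpa using h X Z)
  obtain ⟨X0, Z, h0⟩ := hex
  have hex2 : ∃ e, S e Z ≠ 0 ∧ S (J e) Z = 0 := by
    refine ⟨S X0 Z • X0 + S (J X0) Z • J X0, ?_, ?_⟩
    · have : 0 < S X0 Z ^ 2 := by positivity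
      have h2 := sq_nonneg (S (J X0) Z)
      simp only [map_add, map_smul, LinearMap.add_apply, LinearMap.smul_apply, smul_eq_mul]
      nlinarith
    · simp only [map_add, map_smul, LinearMap.add_apply, LinearMap.smul_apply, smul_eq_mul,
        hJ2, map_neg, LinearMap.neg_apply]
      ring
  obtain ⟨e, hc, hc'⟩ := hex2
  have hb : ∀ U W, F U e W = 0 := by
    intro U W
    have h := hMain U e (J e) Z W
    simp only [hJ2, map_neg, LinearMap.neg_apply, hc'] at h
    have : S e Z * F U e W = 0 := by linarith
    exact (mul_eq_zero.mp this).resolve_left hc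
  have key : ∀ U Y W, S e Z * F U (J Y) W = S Y Z * F U (J e) W := by
    intro U Y W
    have h := hMain U e Y Z W
    rw [hc', hb] at h
    linarith
  have hself : ∀ U X, F U X X = 0 := by
    intro U X
    have := hF1 U X X
    linarith
  have hJe : ∀ U W, F U (J e) W = 0 := by
    intro U W
    have h := key U (J W) (J e)
    rw [hself, hJ2, map_neg, LinearMap.neg_apply, hF1 U (J e) W, mul_zero] at h
    have : S e Z * F U (J e) W = 0 := by linarith
    exact (mul_eq_zero.mp this).resolve_left hc
  ext U X W
  have h := key U (J X) W
  rw [hJe, hJ2, map_neg, LinearMap.neg_apply, mul_zero] at h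
  have : S e Z * F U X W = 0 := by linarith
  simpa using (mul_eq_zero.mp this).resolve_left hc
end
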